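/- arXiv:math/0412272 — 8 statements merged into one kernel-verified Lean document; each statement's English description precedes it below -/
import Mathlib

section
/- Let g ≥ 1 and let w ∈ W_g be final. Then ℓ(w) = Σ_{i=1}^g ν_w(i), i.e. the length of w equals Σ_{i=1}^g (i − #{a ≤ g : w(a) ≤ i}). -/
/-- `W_g`: the subgroup of permutations of `{1,…,2g}` (0-indexed as `Fin (2*g)`)
satisfying `w(i) + w(2g+1−i) = 2g+1` (in 1-indexed terms). -/
def IsWeylC (g : ℕ) (w : Equiv.Perm (Fin (2 * g))) : Prop :=
  ∀ i : Fin (2 * g), ((w i : ℕ) + 1) + ((w i.rev : ℕ) + 1) = 2 * g + 1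

/-- `r_w(i,j) = #{a : 1 ≤ a ≤ i, w(a) ≤ j}` (with `i j` 1-indexed bounds). -/
def rW (g : ℕ) (w : Equiv.Perm (Fin (2 * g))) (i j : ℕ) : ℕ :=
  (Finset.univ.filter (fun a : Fin (2 * g) => (a : ℕ) < i ∧ (w a : ℕ) < j)).card

/-- `w` is final: `w(i) < w(j)` for all `1 ≤ i < j ≤ g`. -/
def IsFinalElt (g : ℕ) (w : Equiv.Perm (Fin (2 * g))) : Prop :=
  ∀ i j : Fin (2 * g), (i : ℕ) < (j : ℕ) → (j : ℕ) < g → (w i : ℕ) < (w j : ℕ)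

/-- The length `ℓ(w) = #{(i,j) : 1 ≤ i < j ≤ g, w(i) > w(j)}
+ #{(i,j) : 1 ≤ i ≤ j ≤ g, w(i)+w(j) > 2g+1}` (all 1-indexed). -/
def lenC (g : ℕ) (w : Equiv.Perm (Fin (2 * g))) : ℕ :=
  (Finset.univ.filter (fun p : Fin (2 * g) × Fin (2 * g) =>
      (p.1 : ℕ) < (p.2 : ℕ) ∧ (p.2 : ℕ) < g ∧ (w p.2 : ℕ) < (w p.1 : ℕ))).card +
  (Finset.univ.filter (fun p : Fin (2 * g) × Fin (2 * g) =>
      (p.1 : ℕ) ≤ (p.2 : ℕ) ∧ (p.2 : ℕ) < g ∧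
        2 * g + 1 < ((w p.1 : ℕ) + 1) + ((w p.2 : ℕ) + 1))).card

theorem card_filter_lt_eq_zero_of_isFinalElt {g : ℕ} {w : Equiv.Perm (Fin (2 * g))}
    (hfin : IsFinalElt g w) :
    (Finset.univ.filter (fun p : Fin (2 * g) × Fin (2 * g) =>
      (p.1 : ℕ) < (p.2 : ℕ) ∧ (p.2 : ℕ) < g ∧ (w p.2 : ℕ) < (w p.1 : ℕ))).card = 0 := by
  rw [Finset.card_eq_zero, Finset.filter_eq_empty_iff]
  rintro ⟨i, j⟩ - ⟨h₁, h₂, h₃⟩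
  exact absurd (hfin i j h₁ h₂) h₃.not_gt

theorem IsFinalElt.apply_le {g : ℕ} {w : Equiv.Perm (Fin (2 * g))} (hfin : IsFinalElt g w)
    {i j : Fin (2 * g)} (hij : (i : ℕ) ≤ j) (hj : (j : ℕ) < g) : (w i : ℕ) ≤ w j := by
  rcases hij.lt_or_eq with h | h
  · exact (hfin i j h hj).le
  · rw [Fin.ext h]

/-- For fixed `j`, the pairs `(i, j)` contributing to the length of a final element are
matched with the interval `[g, w j]` through `i ↦ max (w i) (2g - 1 - w i)`. -/
theorem card_filter_le_add_apply {g : ℕ} {w : Equiv.Perm (Fin (2 * g))}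
    (hw : IsWeylC g w) (hfin : IsFinalElt g w) (j : Fin (2 * g)) (hj : (j : ℕ) < g) :
    (Finset.univ.filter (fun i : Fin (2 * g) =>
      (i : ℕ) ≤ j ∧ 2 * g + 1 < ((w i : ℕ) + 1) + ((w j : ℕ) + 1))).card
      = (w j : ℕ) + 1 - g := by
  rw [← Nat.card_Icc]
  refine Finset.card_bij (fun i _ => max (w i : ℕ) (2 * g - 1 - w i)) ?_ ?_ ?_
  · intro i hi
    simp only [Finset.mem_filter, Finset.mem_univ, true_and] at hi
    have := hfin.apply_le hi.1 hj
    rw [Finset.mem_Icc]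
    omega
  · intro a ha b hb hab
    simp only [Finset.mem_filter, Finset.mem_univ, true_and] at ha hb
    have hwb := hw b
    have hrev := Fin.val_rev b
    by_cases h : (w a : ℕ) = w b
    · exact w.injective (Fin.ext h)
    · have hval : (w a : ℕ) = w b.rev := by
        have := (w a).isLt
        omega
      have hab' : (a : ℕ) = b.rev := congrArg Fin.val (w.injective (Fin.ext hval))
      omega
  · intro t ht
    rw [Finset.mem_Icc] at ht
    have htlt : t < 2 * g := ht.2.trans_lt (w j).isLt
    obtain ⟨a, ha⟩ := w.surjective ⟨t, htlt⟩
    have hat : (w a : ℕ) = t := congrArg Fin.val ha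
    have hwa := hw a
    have hrev := Fin.val_rev a
    have key : ∀ b : Fin (2 * g), (b : ℕ) < g → (w b : ℕ) ≤ w j → (b : ℕ) ≤ j := by
      intro b hb hle
      by_contra hlt
      exact absurd (hfin j b (not_le.mp hlt) hb) hle.not_gt
    by_cases hag : (a : ℕ) < g
    · refine ⟨a, ?_, by omega⟩
      simp only [Finset.mem_filter, Finset.mem_univ, true_and]
      exact ⟨key a hag (by omega), by omega⟩
    · have hne : t ≠ w j := by
        intro h
        have : (a : ℕ) = j := congrArg Fin.val (w.injective (Fin.ext (hat.trans h)))
        omega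
      refine ⟨a.rev, ?_, by omega⟩
      simp only [Finset.mem_filter, Finset.mem_univ, true_and]
      exact ⟨key _ (by omega) (by omega), by omega⟩

theorem lenC_eq_sum_of_isFinalElt {g : ℕ} {w : Equiv.Perm (Fin (2 * g))}
    (hw : IsWeylC g w) (hfin : IsFinalElt g w) :
    lenC g w = ∑ j with Fin.val j < g, ((w j : ℕ) + 1 - g) := by
  rw [lenC, card_filter_lt_eq_zero_of_isFinalElt hfin, zero_add,
    Finset.card_eq_sum_card_fiberwise (f := Prod.snd)
      (t := Finset.univ.filter (fun j : Fin (2 * g) => (j : ℕ) < g))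
      (fun p hp => by simp_all)]
  refine Finset.sum_congr rfl fun j hj => ?_
  have hjg : (j : ℕ) < g := by simpa using hj
  rw [← card_filter_le_add_apply hw hfin j hjg]
  refine Finset.card_bij (fun p _ => p.1) ?_ ?_ ?_
  · rintro ⟨i, k⟩ h
    simp only [Finset.mem_filter, Finset.mem_univ, true_and] at h ⊢
    obtain ⟨⟨h₁, -, h₃⟩, rfl⟩ := h
    exact ⟨h₁, h₃⟩
  · rintro ⟨i, k⟩ h ⟨i', k'⟩ h' hii
    simp only [Finset.mem_filter] at h h'
    exact Prod.ext hii (h.2.trans h'.2.symm)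
  · intro i hi
    refine ⟨(i, j), ?_, rfl⟩
    simp only [Finset.mem_filter, Finset.mem_univ, true_and] at hi ⊢
    exact ⟨⟨hi.1, hjg, hi.2⟩, trivial⟩

theorem card_filter_apply_lt {n : ℕ} (w : Equiv.Perm (Fin n)) {i : ℕ} (hi : i ≤ n) :
    (Finset.univ.filter (fun a => (w a : ℕ) < i)).card = i := by
  conv_rhs => rw [← Finset.card_range i]
  refine Finset.card_bij (fun a _ => (w a : ℕ)) ?_ ?_ ?_
  · intro a ha
    simpa using ha
  · intro a _ b _ h
    exact w.injective (Fin.ext h)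
  · intro t ht
    rw [Finset.mem_range] at ht
    obtain ⟨a, ha⟩ := w.surjective ⟨t, ht.trans_le hi⟩
    exact ⟨a, by simp [ha, ht], by simp [ha]⟩

theorem sub_rW_eq_card {g : ℕ} {w : Equiv.Perm (Fin (2 * g))} (hw : IsWeylC g w) {i : ℕ}
    (hi : i ≤ g) :
    i - rW g w g i =
      (Finset.univ.filter (fun a : Fin (2 * g) => (a : ℕ) < g ∧ 2 * g - w a ≤ i)).card := by
  have hsplit := Finset.card_filter_add_card_filter_not
    (s := Finset.univ.filter (fun a : Fin (2 * g) => (w a : ℕ) < i)) (fun a => (a : ℕ) < g)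
  rw [card_filter_apply_lt w (by omega), Finset.filter_filter, Finset.filter_filter] at hsplit
  have hr : rW g w g i =
      (Finset.univ.filter (fun a : Fin (2 * g) => (w a : ℕ) < i ∧ (a : ℕ) < g)).card := by
    simp only [rW, and_comm]
  have hrev : (Finset.univ.filter
        (fun a : Fin (2 * g) => (w a : ℕ) < i ∧ ¬ (a : ℕ) < g)).card =
      (Finset.univ.filter (fun a : Fin (2 * g) => (a : ℕ) < g ∧ 2 * g - w a ≤ i)).card := by
    refine Finset.card_equiv Fin.revPerm fun a => ?_
    have hwa := hw a
    have hval := Fin.val_rev a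
    simp only [Finset.mem_filter, Finset.mem_univ, true_and, Fin.revPerm_apply]
    omega
  omega

theorem sum_sub_rW {g : ℕ} {w : Equiv.Perm (Fin (2 * g))} (hw : IsWeylC g w) :
    ∑ i ∈ Finset.Icc 1 g, (i - rW g w g i) =
      ∑ j with Fin.val j < g, ((w j : ℕ) + 1 - g) := by
  have hswap := Finset.sum_card_bipartiteAbove_eq_sum_card_bipartiteBelow
    (s := Finset.Icc 1 g) (t := Finset.univ.filter (fun a : Fin (2 * g) => (a : ℕ) < g))
    (fun i a => 2 * g - (w a : ℕ) ≤ i)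
  calc ∑ i ∈ Finset.Icc 1 g, (i - rW g w g i)
      = _ := Finset.sum_congr rfl fun i hi => by
        rw [sub_rW_eq_card hw (Finset.mem_Icc.mp hi).2, Finset.bipartiteAbove,
          Finset.filter_filter]
    _ = _ := hswap
    _ = _ := Finset.sum_congr rfl fun a _ => by
        have hlt := (w a).isLt
        have hset : Finset.bipartiteBelow (fun i a => 2 * g - (w a : ℕ) ≤ i)
            (Finset.Icc 1 g) a = Finset.Icc (2 * g - (w a : ℕ)) g := by
          ext i
          simp only [Finset.mem_bipartiteBelow, Finset.mem_Icc]
          omega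
        rw [hset, Nat.card_Icc]
        omega

/-- for a final element `w ∈ W_g`,
`ℓ(w) = Σ_{i=1}^g ν_w(i) = Σ_{i=1}^g (i − #{a ≤ g : w(a) ≤ i})`. -/
theorem stmt2 (g : ℕ) (hg : 1 ≤ g) (w : Equiv.Perm (Fin (2 * g)))
    (hw : IsWeylC g w) (hfin : IsFinalElt g w) :
    lenC g w = ∑ i ∈ Finset.Icc 1 g, (i - rW g w g i) := by
  rw [lenC_eq_sum_of_isFinalElt hw hfin, sum_sub_rW hw]
end

section
/- Let g ≥ 1. For every w ∈ W_g the function ν_w is a final type of degree g, and ν_w = ν_{w′} whenever wW_H = w′W_H. Moreover the assignment w ↦ ν_w restricts to a bijection from the set of final elements of W_g onto the set of final types of degree g, and both of these sets have cardinality 2^g. -/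
/-- `W_H`: the subgroup of `W_g` of elements stabilizing `{1,…,g}`. -/
def IsWH (g : ℕ) (h : Equiv.Perm (Fin (2 * g))) : Prop :=
  IsWeylC g h ∧ ∀ i : Fin (2 * g), (i : ℕ) < g → (h i : ℕ) < g

/-- `ν_w(i) = i − r_w(g,i)`, as a function `{0,…,2g} → {0,…,g}`
(extended by the constant value `g` beyond `2g`). -/
def nuW (g : ℕ) (w : Equiv.Perm (Fin (2 * g))) : ℕ → ℕ :=
  fun i => if i ≤ 2 * g then i - rW g w g i else g

/-- A final type of degree `g`: an increasing surjective map
`{0,…,2g} → {0,…,g}` with `ν(2g−i) = ν(i) − i + g` for `0 ≤ i ≤ g`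
(encoded as a function `ℕ → ℕ` that is constant `= g` beyond `2g`). -/
def IsFinalType (g : ℕ) (ν : ℕ → ℕ) : Prop :=
  (∀ i, i ≤ 2 * g → ν i ≤ g) ∧
  (∀ i j, i ≤ j → j ≤ 2 * g → ν i ≤ ν j) ∧
  (∀ m, m ≤ g → ∃ i, i ≤ 2 * g ∧ ν i = m) ∧
  (∀ i, i ≤ g → ν (2 * g - i) + i = ν i + g) ∧
  (∀ i, 2 * g < i → ν i = g)

/-- The function `{0,…,2g} → ℕ` counting the `v < i` with `p v`, extended by `g` beyond `2g`. -/
def countType (g : ℕ) (p : ℕ → Prop) [DecidablePred p] : ℕ → ℕ :=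
  fun i => if i ≤ 2 * g then Nat.count p i else g

lemma count_add_eq_of_antisymm {n : ℕ} {p : ℕ → Prop} [DecidablePred p]
    (hp : ∀ v, v < n → (p (n - 1 - v) ↔ ¬ p v)) (i : ℕ) (hi : i ≤ n) :
    Nat.count p (n - i) + i = Nat.count p i + Nat.count p n := by
  induction i with
  | zero => simp
  | succ k ih =>
    have ih := ih (by omega)
    have e : n - k = (n - 1 - k) + 1 := by omega
    rw [e, Nat.count_succ] at ih
    rw [Nat.count_succ, show n - (k + 1) = n - 1 - k by omega]
    have := hp k (by omega)
    by_cases h : p k <;> simp only [this, h, not_true, not_false_iff, if_true, if_false] at ih ⊢ <;>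
      omega

lemma exists_count_eq (p : ℕ → Prop) [DecidablePred p] (n m : ℕ) (hm : m ≤ Nat.count p n) :
    ∃ i ≤ n, Nat.count p i = m := by
  induction n with
  | zero => exact ⟨0, le_rfl, by simp at hm ⊢; omega⟩
  | succ n ih =>
    by_cases h : m ≤ Nat.count p n
    · obtain ⟨i, hi, e⟩ := ih h
      exact ⟨i, by omega, e⟩
    · refine ⟨n + 1, le_rfl, ?_⟩
      rw [Nat.count_succ] at hm ⊢
      split_ifs at hm ⊢ <;> omega

lemma isFinalType_countType {g : ℕ} {p : ℕ → Prop} [DecidablePred p]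
    (hp : ∀ v, v < 2 * g → (p (2 * g - 1 - v) ↔ ¬ p v)) : IsFinalType g (countType g p) := by
  have key := count_add_eq_of_antisymm hp
  have hg : Nat.count p (2 * g) = g := by
    have := key g (by omega)
    rw [show 2 * g - g = g by omega] at this
    omega
  refine ⟨fun i hi => ?_, fun i j hij hj => ?_, fun m hm => ?_, fun i hi => ?_, fun i hi => ?_⟩
  · rw [countType, if_pos hi]
    exact (Nat.count_monotone p hi).trans hg.le
  · rw [countType, countType, if_pos hj, if_pos (hij.trans hj)]
    exact Nat.count_monotone p hij
  · obtain ⟨i, hi, e⟩ := exists_count_eq p (2 * g) m (by omega)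
    exact ⟨i, hi, by rw [countType, if_pos hi, e]⟩
  · rw [countType, countType, if_pos (by omega), if_pos (by omega), key i (by omega), hg]
  · rw [countType, if_neg (by omega)]

lemma countType_eq_iff {g : ℕ} {p q : ℕ → Prop} [DecidablePred p] [DecidablePred q] :
    countType g p = countType g q ↔ ∀ v < 2 * g, (p v ↔ q v) := by
  constructor
  · intro h v hv
    have h0 := congrFun h v
    have h1 := congrFun h (v + 1)
    simp only [countType, if_pos hv.le, if_pos (Nat.succ_le_of_lt hv), Nat.count_succ] at h0 h1
    by_cases hp : p v <;> by_cases hq : q v <;> simp_all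
  · intro h
    funext i
    simp only [countType]
    split_ifs with hi
    · induction i with
      | zero => simp
      | succ k ih => rw [Nat.count_succ, Nat.count_succ, ih (by omega)]; simp only [h k (by omega)]
    · rfl

namespace IsFinalType

variable {g : ℕ} {ν : ℕ → ℕ}

lemma map_zero (h : IsFinalType g ν) : ν 0 = 0 := by
  obtain ⟨-, hm, hs, -, -⟩ := h
  obtain ⟨i, hi, e⟩ := hs 0 (by omega)
  have := hm 0 i (by omega) hi
  omega

lemma map_succ (h : IsFinalType g ν) {v : ℕ} (hv : v < 2 * g) :
    ν (v + 1) = ν v ∨ ν (v + 1) = ν v + 1 := by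
  obtain ⟨hb, hm, hs, -, -⟩ := h
  have h1 := hm v (v + 1) (by omega) (by omega)
  by_contra! hc
  have h2 := hb (v + 1) (by omega)
  obtain ⟨i, hi, e⟩ := hs (ν v + 1) (by omega)
  rcases Nat.lt_or_ge v i with h3 | h3
  · have := hm (v + 1) i h3 hi
    omega
  · have := hm i v h3 hv.le
    omega

lemma step_antisymm (h : IsFinalType g ν) (v : ℕ) (hv : v < 2 * g) :
    ν (2 * g - 1 - v + 1) = ν (2 * g - 1 - v) + 1 ↔ ¬ ν (v + 1) = ν v + 1 := by
  have aux : ∀ v < g, ν (2 * g - 1 - v + 1) + ν (v + 1) = ν (2 * g - 1 - v) + ν v + 1 := by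
    intro v hv
    have h1 := h.2.2.2.1 v hv.le
    have h2 := h.2.2.2.1 (v + 1) hv
    rw [show 2 * g - (v + 1) = 2 * g - 1 - v by omega] at h2
    rw [show 2 * g - 1 - v + 1 = 2 * g - v by omega]
    omega
  have h1 := h.map_succ hv
  rcases Nat.lt_or_ge v g with h3 | h3
  · have := aux v h3
    omega
  · have := aux (2 * g - 1 - v) (by omega)
    rw [show 2 * g - 1 - (2 * g - 1 - v) = v by omega] at this
    omega

lemma countType_step (h : IsFinalType g ν) : countType g (fun v => ν (v + 1) = ν v + 1) = ν := by
  funext i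
  simp only [countType]
  split_ifs with hi
  · induction i with
    | zero => simp [h.map_zero]
    | succ k ih =>
      rw [Nat.count_succ, ih (by omega)]
      have := h.map_succ (v := k) (by omega)
      split_ifs <;> omega
  · exact (h.2.2.2.2 i (by omega)).symm

end IsFinalType

open scoped Classical in
lemma nuW_eq_countType (g : ℕ) (w : Equiv.Perm (Fin (2 * g))) :
    nuW g w = countType g (fun v => ¬ ∃ a : Fin (2 * g), (a : ℕ) < g ∧ (w a : ℕ) = v) := by
  have key : ∀ i ≤ 2 * g, rW g w g i +
      Nat.count (fun v => ¬ ∃ a : Fin (2 * g), (a : ℕ) < g ∧ (w a : ℕ) = v) i = i := by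
    intro i hi
    induction i with
    | zero => simp [rW]
    | succ k ih =>
      have ih := ih (by omega)
      have hr : rW g w g (k + 1) = rW g w g k +
          if ∃ a : Fin (2 * g), (a : ℕ) < g ∧ (w a : ℕ) = k then 1 else 0 := by
        unfold rW
        split_ifs with hk
        · obtain ⟨a, ha, e⟩ := hk
          rw [← Finset.card_insert_of_notMem (a := a) (by simp [e])]
          congr 1
          ext b
          simp only [Finset.mem_filter, Finset.mem_univ, true_and, Finset.mem_insert]
          constructor
          · rintro ⟨h1, h2⟩
            rcases Nat.lt_succ_iff_lt_or_eq.1 h2 with h3 | h3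
            · exact Or.inr ⟨h1, h3⟩
            · exact Or.inl (w.injective (Fin.ext (h3.trans e.symm)))
          · rintro (rfl | ⟨h1, h2⟩)
            · exact ⟨ha, by omega⟩
            · exact ⟨h1, by omega⟩
        · rw [add_zero]
          congr 1
          ext b
          simp only [Finset.mem_filter, Finset.mem_univ, true_and]
          have : (b : ℕ) < g → (w b : ℕ) ≠ k := fun h e => hk ⟨b, h, e⟩
          grind
      rw [hr, Nat.count_succ]
      split_ifs <;> omega
  funext i
  simp only [nuW, countType]
  split_ifs with hi
  · have := key i hi
    omega
  · rfl

namespace IsWeylC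

variable {g : ℕ} {w w' : Equiv.Perm (Fin (2 * g))}

lemma apply_rev (h : IsWeylC g w) (i : Fin (2 * g)) : w i.rev = (w i).rev := by
  have := h i
  ext
  rw [Fin.val_rev (w i)]
  omega

lemma exists_image_antisymm (h : IsWeylC g w) (v : ℕ) (hv : v < 2 * g) :
    (¬ ∃ a : Fin (2 * g), (a : ℕ) < g ∧ (w a : ℕ) = 2 * g - 1 - v) ↔
      ¬ ¬ ∃ a : Fin (2 * g), (a : ℕ) < g ∧ (w a : ℕ) = v := by
  obtain ⟨b, hb⟩ := w.surjective ⟨v, hv⟩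
  have hb' : (w b : ℕ) = v := by rw [hb]
  have hr : (w b.rev : ℕ) = 2 * g - 1 - v := by have := h b; omega
  have e1 : (∃ a : Fin (2 * g), (a : ℕ) < g ∧ (w a : ℕ) = v) ↔ (b : ℕ) < g := by
    refine ⟨?_, fun h => ⟨b, h, hb'⟩⟩
    rintro ⟨a, ha, e⟩
    rwa [← w.injective (Fin.ext (e.trans hb'.symm))]
  have e2 : (∃ a : Fin (2 * g), (a : ℕ) < g ∧ (w a : ℕ) = 2 * g - 1 - v) ↔ (b.rev : ℕ) < g := by
    refine ⟨?_, fun h => ⟨b.rev, h, hr⟩⟩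
    rintro ⟨a, ha, e⟩
    rwa [← w.injective (Fin.ext (e.trans hr.symm))]
  rw [e1, e2, Fin.val_rev]
  have := b.2
  omega

lemma isFinalType_nuW (h : IsWeylC g w) : IsFinalType g (nuW g w) := by
  classical
  rw [nuW_eq_countType]
  exact isFinalType_countType h.exists_image_antisymm

lemma ext_of_eq_on (h : IsWeylC g w) (h' : IsWeylC g w')
    (he : ∀ a : Fin (2 * g), (a : ℕ) < g → w a = w' a) : w = w' := by
  ext a : 1
  rcases Nat.lt_or_ge a g with ha | ha
  · exact he a ha
  · have := he a.rev (by rw [Fin.val_rev]; omega)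
    rw [h.apply_rev, h'.apply_rev] at this
    exact Fin.rev_injective this

end IsWeylC

lemma IsWH.lt_iff {g : ℕ} {h : Equiv.Perm (Fin (2 * g))} (hh : IsWH g h) (a : Fin (2 * g)) :
    (h a : ℕ) < g ↔ (a : ℕ) < g := by
  refine ⟨fun h1 => ?_, hh.2 a⟩
  by_contra h2
  have h3 := hh.2 a.rev (by rw [Fin.val_rev]; omega)
  have := hh.1 a
  omega

lemma nuW_mul_of_isWH {g : ℕ} (w : Equiv.Perm (Fin (2 * g))) {h : Equiv.Perm (Fin (2 * g))}
    (hh : IsWH g h) : nuW g (w * h) = nuW g w := by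
  classical
  rw [nuW_eq_countType, nuW_eq_countType, countType_eq_iff]
  intro v _
  refine not_congr ⟨?_, ?_⟩
  · rintro ⟨a, ha, e⟩
    exact ⟨h a, hh.2 a ha, e⟩
  · rintro ⟨a, ha, e⟩
    refine ⟨h.symm a, (hh.lt_iff _).1 (by simpa using ha), by simpa using e⟩

lemma injOn_nuW (g : ℕ) : Set.InjOn (nuW g) {w | IsWeylC g w ∧ IsFinalElt g w} := by
  classical
  rintro w ⟨hw, fw⟩ w' ⟨hw', fw'⟩ h
  rw [nuW_eq_countType, nuW_eq_countType, countType_eq_iff] at h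
  refine hw.ext_of_eq_on hw' fun a ha => ?_
  let f (u : Equiv.Perm (Fin (2 * g))) (b : Fin g) : ℕ := u ⟨b, by omega⟩
  have hf : ∀ u, IsFinalElt g u → StrictMono (f u) := fun u hu b c hbc => hu _ _ hbc c.2
  have hr : ∀ u v, v ∈ Set.range (f u) ↔ ∃ a : Fin (2 * g), (a : ℕ) < g ∧ (u a : ℕ) = v := by
    intro u v
    constructor
    · rintro ⟨b, rfl⟩
      exact ⟨⟨b, by omega⟩, b.2, rfl⟩
    · rintro ⟨b, hb, rfl⟩
      exact ⟨⟨b, hb⟩, rfl⟩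
  have he : f w = f w' := by
    rw [← StrictMono.range_inj (hf w fw) (hf w' fw')]
    ext v
    by_cases hv : v < 2 * g
    · rw [hr, hr]
      exact not_iff_not.1 (h v hv)
    · refine ⟨?_, ?_⟩ <;> rintro ⟨b, rfl⟩ <;> exact absurd (Fin.is_lt _) hv
  exact Fin.ext (congrFun he ⟨a, ha⟩)

lemma exists_isFinalElt_image {g : ℕ} (S : Finset (Fin (2 * g)))
    (hS : ∀ v, v.rev ∈ S ↔ v ∉ S) :
    ∃ w : Equiv.Perm (Fin (2 * g)), (IsWeylC g w ∧ IsFinalElt g w) ∧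
      ∀ v, (∃ a : Fin (2 * g), (a : ℕ) < g ∧ w a = v) ↔ v ∈ S := by
  have hc : S.card = g := by
    have h1 : S.map Fin.revPerm.toEmbedding = Sᶜ := by
      ext v
      rw [Finset.mem_map_equiv, Finset.mem_compl, ← hS]
      simp
    have h2 := S.card_add_card_compl
    rw [← h1, Finset.card_map, Fintype.card_fin] at h2
    omega
  let e := S.orderEmbOfFin hc
  have heS : ∀ b, e b ∈ S := S.orderEmbOfFin_mem hc
  let u (a : Fin (2 * g)) : Fin (2 * g) :=
    if h : (a : ℕ) < g then e ⟨a, h⟩ else (e ⟨2 * g - 1 - a, by omega⟩).rev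
  have u_lt : ∀ a : Fin (2 * g), ∀ h : (a : ℕ) < g, u a = e ⟨a, h⟩ := fun a h => dif_pos h
  have u_rev : ∀ a, u a.rev = (u a).rev := by
    intro a
    by_cases h : (a : ℕ) < g
    · have h' : ¬ (a.rev : ℕ) < g := by rw [Fin.val_rev]; omega
      simp only [u, dif_pos h, dif_neg h', Fin.val_rev]
      congr 3
      omega
    · have h' : (a.rev : ℕ) < g := by rw [Fin.val_rev]; omega
      simp only [u, dif_neg h, dif_pos h', Fin.val_rev, Fin.rev_rev]
      congr 2
      omega
  have u_mem : ∀ a, u a ∈ S ↔ (a : ℕ) < g := by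
    intro a
    by_cases h : (a : ℕ) < g
    · simp only [u_lt a h, heS, h]
    · have h' : (a.rev : ℕ) < g := by rw [Fin.val_rev]; omega
      have := (hS (u a)).1 (by rw [← u_rev, u_lt _ h']; exact heS _)
      simp only [this, h]
  have inj_lt : ∀ a b : Fin (2 * g), (a : ℕ) < g → (b : ℕ) < g → u a = u b → a = b := by
    intro a b ha hb h
    rw [u_lt a ha, u_lt b hb] at h
    exact Fin.ext (Fin.mk.inj (e.injective h))
  have u_inj : Function.Injective u := by
    intro a b h
    by_cases ha : (a : ℕ) < g
    · exact inj_lt a b ha ((u_mem b).1 (h ▸ (u_mem a).2 ha)) h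
    · have hb : ¬ (b : ℕ) < g := fun hb => ha ((u_mem a).1 (h ▸ (u_mem b).2 hb))
      refine Fin.rev_injective (inj_lt _ _ ?_ ?_ ?_)
      · rw [Fin.val_rev]; omega
      · rw [Fin.val_rev]; omega
      · rw [u_rev, u_rev, h]
  refine ⟨Equiv.ofBijective u (Finite.injective_iff_bijective.1 u_inj), ⟨fun i => ?_, ?_⟩,
    fun v => ⟨?_, fun hv => ?_⟩⟩
  · simp only [Equiv.ofBijective_apply, u_rev, Fin.val_rev]
    omega
  · intro i j hij hj
    simp only [Equiv.ofBijective_apply, u_lt i (hij.trans hj), u_lt j hj]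
    exact e.strictMono hij
  · rintro ⟨a, ha, rfl⟩
    exact (u_mem a).2 ha
  · obtain ⟨a, rfl⟩ := (Finite.injective_iff_surjective.1 u_inj) v
    exact ⟨a, (u_mem a).1 hv, rfl⟩

lemma surjOn_nuW (g : ℕ) :
    Set.SurjOn (nuW g) {w | IsWeylC g w ∧ IsFinalElt g w} {ν | IsFinalType g ν} := by
  classical
  intro ν hν
  have hν : IsFinalType g ν := hν
  obtain ⟨w, hw, hS⟩ := exists_isFinalElt_image
    (Finset.univ.filter fun v : Fin (2 * g) => ¬ ν (v + 1) = ν v + 1) (by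
      intro v
      have := hν.step_antisymm v v.2
      rw [show 2 * g - 1 - (v : ℕ) = (v.rev : ℕ) by rw [Fin.val_rev]; omega] at this
      simp only [Finset.mem_filter, Finset.mem_univ, true_and, this])
  refine ⟨w, hw, ?_⟩
  rw [nuW_eq_countType, ← hν.countType_step, countType_eq_iff]
  intro v hv
  have := hS ⟨v, hv⟩
  simp only [Finset.mem_filter, Finset.mem_univ, true_and, Fin.ext_iff] at this
  rw [this, not_not]

lemma bijOn_nuW (g : ℕ) :
    Set.BijOn (nuW g) {w | IsWeylC g w ∧ IsFinalElt g w} {ν | IsFinalType g ν} :=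
  ⟨fun _ hw => hw.1.isFinalType_nuW, injOn_nuW g, surjOn_nuW g⟩

lemma card_isFinalType (g : ℕ) : Nat.card {ν : ℕ → ℕ // IsFinalType g ν} = 2 ^ g := by
  classical
  let Φ (ν : {ν : ℕ → ℕ // IsFinalType g ν}) (i : Fin g) : Prop := ν.1 (i + 1) = ν.1 i + 1
  have hΦ : Function.Bijective Φ := by
    constructor
    · rintro ⟨ν, hν⟩ ⟨μ, hμ⟩ h
      have aux : ∀ v < g, (ν (v + 1) = ν v + 1 ↔ μ (v + 1) = μ v + 1) :=
        fun v hv => iff_of_eq (congrFun h ⟨v, hv⟩)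
      refine Subtype.ext (?_ : ν = μ)
      rw [← hν.countType_step, ← hμ.countType_step, countType_eq_iff]
      intro v hv
      rcases Nat.lt_or_ge v g with h1 | h1
      · exact aux v h1
      · have := aux (2 * g - 1 - v) (by omega)
        rwa [hν.step_antisymm v hv, hμ.step_antisymm v hv, not_iff_not] at this
    · intro q
      let q' (v : ℕ) : Prop := ∃ h : v < g, q ⟨v, h⟩
      let p (v : ℕ) : Prop := if v < g then q' v else ¬ q' (2 * g - 1 - v)
      have hp : ∀ v, v < 2 * g → (p (2 * g - 1 - v) ↔ ¬ p v) := by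
        intro v hv
        rcases Nat.lt_or_ge v g with h1 | h1
        · simp only [p, if_pos h1, if_neg (show ¬ 2 * g - 1 - v < g by omega),
            show 2 * g - 1 - (2 * g - 1 - v) = v by omega]
        · simp only [p, if_neg (show ¬ v < g by omega), if_pos (show 2 * g - 1 - v < g by omega),
            not_not]
      refine ⟨⟨countType g p, isFinalType_countType hp⟩, ?_⟩
      funext i
      have hi : (i : ℕ) < 2 * g := by omega
      have hpi : p i ↔ q i := by simp [p, q']
      simp only [Φ, countType, if_pos hi.le, if_pos (Nat.succ_le_of_lt hi), Nat.count_succ,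
        eq_iff_iff, ← hpi]
      split_ifs with h <;> simp [h]
  rw [Nat.card_congr (Equiv.ofBijective Φ hΦ)]
  simp

/-- `ν_w` is a final type for every `w ∈ W_g`; it only depends on
the coset `w·W_H`; `w ↦ ν_w` restricts to a bijection from the final elements
of `W_g` onto the final types of degree `g`; and both sets have `2^g` elements. -/
theorem stmt3 (g : ℕ) (hg : 1 ≤ g) :
    (∀ w : Equiv.Perm (Fin (2 * g)), IsWeylC g w → IsFinalType g (nuW g w)) ∧
    (∀ w w' : Equiv.Perm (Fin (2 * g)), IsWeylC g w → IsWeylC g w' →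
      (∃ h, IsWH g h ∧ w' = w * h) → nuW g w = nuW g w') ∧
    Set.BijOn (nuW g) {w | IsWeylC g w ∧ IsFinalElt g w} {ν | IsFinalType g ν} ∧
    Nat.card {w : Equiv.Perm (Fin (2 * g)) // IsWeylC g w ∧ IsFinalElt g w} = 2 ^ g ∧
    Nat.card {ν : ℕ → ℕ // IsFinalType g ν} = 2 ^ g := by
  refine ⟨fun w hw => hw.isFinalType_nuW, ?_, bijOn_nuW g, ?_, card_isFinalType g⟩
  · rintro w _ - - ⟨h, hh, rfl⟩
    exact (nuW_mul_of_isWH w hh).symm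
  · rw [← card_isFinalType g]
    exact Nat.card_congr (bijOn_nuW g).equiv
end

section
/- Let g ≥ 1 and let w, w′ ∈ W_g be final elements. Then r_w(i,j) ≥ r_{w′}(i,j) for all 1 ≤ i, j ≤ 2g (i.e. w ≤ w′ in the Bruhat–Chevalley order) if and only if ν_w(i) ≤ ν_{w′}(i) for all 0 ≤ i ≤ 2g. -/
theorem rW_le_left (g : ℕ) (w : Equiv.Perm (Fin (2 * g))) (i j : ℕ) : rW g w i j ≤ i := by
  have h := Finset.card_le_card_of_injOn
    (s := Finset.univ.filter (fun a : Fin (2 * g) => (a : ℕ) < i ∧ (w a : ℕ) < j))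
    (t := Finset.range i) (fun a => (a : ℕ)) (by intro a ha; simp at ha ⊢; exact ha.1)
    (fun a _ b _ hab => Fin.ext hab)
  simpa [rW] using h

theorem rW_le_right (g : ℕ) (w : Equiv.Perm (Fin (2 * g))) (i j : ℕ) : rW g w i j ≤ j := by
  have h := Finset.card_le_card_of_injOn
    (s := Finset.univ.filter (fun a : Fin (2 * g) => (a : ℕ) < i ∧ (w a : ℕ) < j))
    (t := Finset.range j) (fun a => (w a : ℕ)) (by intro a ha; simp at ha ⊢; exact ha.2)
    (fun a _ b _ hab => w.injective (Fin.ext hab))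
  simpa [rW] using h

theorem card_filter_val_lt {n i : ℕ} (hi : i ≤ n) :
    (Finset.univ.filter (fun a : Fin n => (a : ℕ) < i)).card = i := by
  simp [Fin.card_filter_val_lt, hi]

theorem rW_eq_min {g : ℕ} {w : Equiv.Perm (Fin (2 * g))} (hw : IsFinalElt g w) {i : ℕ}
    (hi : i ≤ g) (j : ℕ) : rW g w i j = min i (rW g w g j) := by
  have hmono : rW g w i j ≤ rW g w g j :=
    Finset.card_le_card fun a ha => by simp at ha ⊢; omega
  have hle := rW_le_left g w i j
  by_cases h : ∀ a : Fin (2 * g), (a : ℕ) < i → (w a : ℕ) < j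
  · have hcard : rW g w i j = i := by
      rw [rW, Finset.filter_congr (q := fun a : Fin (2 * g) => (a : ℕ) < i)
        fun a _ => ⟨And.left, fun ha => ⟨ha, h a ha⟩⟩]
      exact card_filter_val_lt (by omega)
    omega
  · push Not at h
    obtain ⟨a, hai, haj⟩ := h
    have hge : rW g w g j ≤ rW g w i j := by
      refine Finset.card_le_card fun b hb => ?_
      simp only [Finset.mem_filter, Finset.mem_univ, true_and] at hb ⊢
      refine ⟨?_, hb.2⟩
      by_contra hbi
      have := hw a b (by omega) hb.1
      omega
    omega

theorem IsWeylC.rW_add {g : ℕ} {w : Equiv.Perm (Fin (2 * g))} (hw : IsWeylC g w) {i j : ℕ}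
    (hi : i ≤ 2 * g) (hj : j ≤ 2 * g) :
    rW g w i j + 2 * g = i + j + rW g w (2 * g - i) (2 * g - j) := by
  set A := Finset.univ.filter (fun a : Fin (2 * g) => (a : ℕ) < i)
  set B := Finset.univ.filter (fun a : Fin (2 * g) => (w a : ℕ) < j)
  have hA : A.card = i := card_filter_val_lt hi
  have hB : B.card = j := by
    rw [← card_filter_val_lt hj]
    exact Finset.card_equiv w (by simp [B])
  have hinter : rW g w i j = (A ∩ B).card := by
    rw [rW, Finset.filter_and]
  have hcompl : rW g w (2 * g - i) (2 * g - j) = (A ∪ B)ᶜ.card := by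
    refine Finset.card_equiv Fin.revPerm fun a => ?_
    have h := hw a
    simp only [Finset.mem_filter, Finset.mem_univ, true_and, Finset.mem_compl, Finset.mem_union,
      Fin.revPerm_apply, Fin.val_rev, A, B]
    omega
  have hunion := Finset.card_union_add_card_inter A B
  have hadd := Finset.card_add_card_compl (A ∪ B)
  rw [Fintype.card_fin] at hadd
  omega

/-- for final elements `w, w' ∈ W_g`, one has
`r_w(i,j) ≥ r_{w'}(i,j)` for all `1 ≤ i,j ≤ 2g` (i.e. `w ≤ w'` in the
Bruhat–Chevalley order) iff `ν_w(i) ≤ ν_{w'}(i)` for all `0 ≤ i ≤ 2g`. -/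
theorem stmt4 (g : ℕ) (hg : 1 ≤ g) (w w' : Equiv.Perm (Fin (2 * g)))
    (hw : IsWeylC g w) (hwfin : IsFinalElt g w)
    (hw' : IsWeylC g w') (hw'fin : IsFinalElt g w') :
    (∀ i j : ℕ, 1 ≤ i → i ≤ 2 * g → 1 ≤ j → j ≤ 2 * g → rW g w' i j ≤ rW g w i j) ↔
      ∀ i : ℕ, i ≤ 2 * g → nuW g w i ≤ nuW g w' i := by
  constructor
  · intro h i hi
    simp only [nuW, if_pos hi]
    rcases Nat.eq_zero_or_pos i with rfl | hpos
    · simp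
    · have := h g i hg (by omega) hpos hi
      omega
  · intro h
    have hmid : ∀ j ≤ 2 * g, rW g w' g j ≤ rW g w g j := by
      intro j hj
      have hj' := h j hj
      simp only [nuW, if_pos hj] at hj'
      have := rW_le_right g w g j
      have := rW_le_right g w' g j
      omega
    have hlow : ∀ i ≤ g, ∀ j ≤ 2 * g, rW g w' i j ≤ rW g w i j := by
      intro i hi j hj
      rw [rW_eq_min hwfin hi, rW_eq_min hw'fin hi]
      exact min_le_min_left i (hmid j hj)
    intro i j _ hi _ hj
    rcases le_total i g with hig | hig
    · exact hlow i hig j hj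
    · have := hw.rW_add hi hj
      have := hw'.rW_add hi hj
      have := hlow (2 * g - i) (by omega) (2 * g - j) (by omega)
      omega
end

section
/- Let g ≥ 1, let w ∈ W_g be a final element with ν := ν_w, and let v be its complementary element. For every 1 ≤ i ≤ g: if ν(i−1) ≠ ν(i) then v^{−1}(i) = ν(i), and if ν(i−1) = ν(i) then v^{−1}(i) = 2g+1 − ν(2g+1−i). -/
/-- `v` is the complementary element of the final element `w`. -/
def IsComplementary (g : ℕ) (w v : Equiv.Perm (Fin (2 * g))) : Prop :=
  IsWeylC g v ∧ IsFinalElt g v ∧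
    (Finset.univ.filter (fun a : Fin (2 * g) => (a : ℕ) < g)).image (fun a => v a) =
      Finset.univ \ (Finset.univ.filter (fun a : Fin (2 * g) => (a : ℕ) < g)).image (fun a => w a)

theorem rW_eq_card_values (g : ℕ) (w : Equiv.Perm (Fin (2 * g))) (i j : ℕ) :
    rW g w i j =
      (Finset.univ.filter
        (fun b : Fin (2 * g) => (b : ℕ) < j ∧ (w.symm b : ℕ) < i)).card := by
  unfold rW
  refine Finset.card_equiv w fun a => ?_
  simp [and_comm]

theorem IsComplementary.symm_lt_iff {g : ℕ} {w v : Equiv.Perm (Fin (2 * g))}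
    (h : IsComplementary g w v) (b : Fin (2 * g)) :
    (v.symm b : ℕ) < g ↔ ¬ (w.symm b : ℕ) < g := by
  have mem_image_iff (u : Equiv.Perm (Fin (2 * g))) :
      b ∈ (Finset.univ.filter (fun a : Fin (2 * g) => (a : ℕ) < g)).image (fun a => u a) ↔
        (u.symm b : ℕ) < g := by
    simp only [Finset.mem_image, Finset.mem_filter, Finset.mem_univ, true_and]
    constructor
    · rintro ⟨a, ha, rfl⟩
      simpa using ha
    · exact fun hb => ⟨u.symm b, hb, u.apply_symm_apply b⟩
  rw [← mem_image_iff v, h.2.2, Finset.mem_sdiff, mem_image_iff w]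
  simp

theorem Fin.card_filter_val_lt_of_le {n i : ℕ} (hi : i ≤ n) :
    (Finset.univ.filter (fun b : Fin n => (b : ℕ) < i)).card = i := by
  rw [Fin.card_filter_val_lt, min_eq_right hi]

theorem IsComplementary.nuW_eq_rW {g : ℕ} {w v : Equiv.Perm (Fin (2 * g))}
    (h : IsComplementary g w v) {i : ℕ} (hi : i ≤ 2 * g) :
    nuW g w i = rW g v g i := by
  have hsum : rW g w g i + rW g v g i = i := by
    rw [rW_eq_card_values, rW_eq_card_values]
    simp only [h.symm_lt_iff, ← Finset.filter_filter]
    rw [Finset.card_filter_add_card_filter_not, Fin.card_filter_val_lt_of_le hi]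
  simp only [nuW, if_pos hi]
  omega

theorem IsFinalElt.rW_succ_apply {g : ℕ} {v : Equiv.Perm (Fin (2 * g))}
    (hv : IsFinalElt g v) (a : Fin (2 * g)) (ha : (a : ℕ) < g) :
    rW g v g ((v a : ℕ) + 1) = (a : ℕ) + 1 := by
  rw [← Fin.card_filter_val_lt_of_le (n := 2 * g) (i := (a : ℕ) + 1) (by omega)]
  unfold rW
  congr 1
  ext b
  simp only [Finset.mem_filter, Finset.mem_univ, true_and]
  constructor
  · rintro ⟨hb, hvb⟩
    by_contra hab
    have := hv a b (by omega) hb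
    omega
  · intro hb
    rcases Nat.lt_or_ge (b : ℕ) a with hlt | hge
    · have := hv b a hlt ha
      omega
    · obtain rfl : b = a := Fin.ext (by omega)
      omega

theorem rW_succ_ne_of_lt {g : ℕ} (v : Equiv.Perm (Fin (2 * g))) {i : ℕ} (a : Fin (2 * g))
    (ha : (a : ℕ) < i) : rW g v i (v a) ≠ rW g v i ((v a : ℕ) + 1) := by
  refine (Finset.card_lt_card ?_).ne
  refine Finset.ssubset_iff_of_subset ?_ |>.mpr ⟨a, by simpa using ha, by simp⟩
  intro b
  simp only [Finset.mem_filter, Finset.mem_univ, true_and]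
  omega

theorem rW_succ_eq_of_le {g : ℕ} (v : Equiv.Perm (Fin (2 * g))) {i : ℕ} (a : Fin (2 * g))
    (ha : i ≤ (a : ℕ)) : rW g v i (v a) = rW g v i ((v a : ℕ) + 1) := by
  unfold rW
  congr 1
  ext b
  simp only [Finset.mem_filter, Finset.mem_univ, true_and]
  refine and_congr_right fun hb => ?_
  have hne : (v b : ℕ) ≠ v a := fun h => by
    have : b = a := v.injective (Fin.ext h)
    omega
  omega

/-- for a final `w ∈ W_g` with `ν := ν_w` and complementary
element `v`: for `1 ≤ i ≤ g`, if `ν(i−1) ≠ ν(i)` then `v⁻¹(i) = ν(i)` and if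
`ν(i−1) = ν(i)` then `v⁻¹(i) = 2g+1 − ν(2g+1−i)`. -/
theorem stmt6 (g : ℕ) (hg : 1 ≤ g) (w v : Equiv.Perm (Fin (2 * g)))
    (hw : IsWeylC g w) (hwfin : IsFinalElt g w)
    (hcomp : IsComplementary g w v) :
    ∀ i : ℕ, ∀ _h1 : 1 ≤ i, ∀ _h2 : i ≤ g,
      (nuW g w (i - 1) ≠ nuW g w i →
        ((v.symm ⟨i - 1, by omega⟩ : Fin (2 * g)) : ℕ) + 1 = nuW g w i) ∧
      (nuW g w (i - 1) = nuW g w i →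
        ((v.symm ⟨i - 1, by omega⟩ : Fin (2 * g)) : ℕ) + 1
          = 2 * g + 1 - nuW g w (2 * g + 1 - i)) := by
  intro i h1 h2
  obtain ⟨a, ha⟩ : ∃ a, a = v.symm ⟨i - 1, by omega⟩ := ⟨_, rfl⟩
  have hva : (v a : ℕ) = i - 1 := by simp [ha]
  rw [← ha, hcomp.nuW_eq_rW (by omega : i - 1 ≤ 2 * g), hcomp.nuW_eq_rW (by omega : i ≤ 2 * g),
    hcomp.nuW_eq_rW (by omega : 2 * g + 1 - i ≤ 2 * g), ← hva,
    show i = (v a : ℕ) + 1 by omega]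
  constructor
  · intro hne
    have hag : (a : ℕ) < g := by
      by_contra hge
      exact hne (rW_succ_eq_of_le v a (by omega))
    exact (hcomp.2.1.rW_succ_apply a hag).symm
  · intro heq
    have hag : g ≤ (a : ℕ) := by
      by_contra hlt
      exact rW_succ_ne_of_lt v a (by omega) heq
    have hrev : (a.rev : ℕ) = 2 * g - (a + 1) := Fin.val_rev a
    have hcount := hcomp.2.1.rW_succ_apply a.rev (by omega)
    have hweyl := hcomp.1 a
    rw [show 2 * g + 1 - ((v a : ℕ) + 1) = (v a.rev : ℕ) + 1 by omega, hcount]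
    omega
end

section
/- Let g ≥ 1, let S ⊆ {0,1,...,2g} be stable and let f be adapted to S and surjective onto S ∩ {0,1,...,g}. Then for any two consecutive elements i < j of S, either f(i) = f(j) or f(j) − f(i) = j − i. -/
/-- `S ⊆ {0,…,2g}` is stable: it contains `0` and is closed under
`i ↦ i^⊥ = 2g − i`. -/
def StableSet (g : ℕ) (S : Set ℕ) : Prop :=
  0 ∈ S ∧ (∀ i ∈ S, i ≤ 2 * g) ∧ (∀ i ∈ S, 2 * g - i ∈ S)

/-- `f` is adapted to the stable set `S`. -/
def AdaptedTo (g : ℕ) (S : Set ℕ) (f : ℕ → ℕ) : Prop :=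
  f 0 = 0 ∧ f (2 * g) = g ∧
  (∀ i ∈ S, f i ∈ S ∧ f i ≤ g) ∧
  (∀ i ∈ S, ∀ j ∈ S, i ≤ j → f i ≤ f j) ∧
  (∀ i ∈ S, ∀ j ∈ S, i < j → f j ≤ f i + (j - i)) ∧
  (∀ i ∈ S, ∀ j ∈ S, i < j → (∀ k ∈ S, ¬(i < k ∧ k < j)) →
    f j = f i + (j - i) → f (2 * g - j) = f (2 * g - i))

/-- `i < j` are consecutive elements of `S`. -/
def IsGap (S : Set ℕ) (i j : ℕ) : Prop :=
  i ∈ S ∧ j ∈ S ∧ i < j ∧ ∀ k ∈ S, ¬(i < k ∧ k < j)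

/-- Reflecting a gap of a stable set gives a gap. -/
theorem IsGap.reflect {g : ℕ} {S : Set ℕ} (hS : StableSet g S) {i j : ℕ} (h : IsGap S i j) :
    IsGap S (2 * g - j) (2 * g - i) := by
  obtain ⟨-, hle, hperp⟩ := hS
  obtain ⟨hi, hj, hij, hgap⟩ := h
  have hj' := hle j hj
  refine ⟨hperp j hj, hperp i hi, by omega, fun k hk hlt => ?_⟩
  exact hgap (2 * g - k) (hperp k hk) (by omega)

/-- A monotone map onto `S ∩ {0,…,g}` sends some gap of `S` onto any given gap of `S ∩ {0,…,g}`. -/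
theorem exists_isGap_map_eq {g : ℕ} {S : Set ℕ} {f : ℕ → ℕ}
    (hf : AdaptedTo g S f) (hsurj : ∀ m ∈ S, m ≤ g → ∃ i ∈ S, f i = m)
    {a b : ℕ} (hab : IsGap S a b) (hb : b ≤ g) :
    ∃ i j, IsGap S i j ∧ f i = a ∧ f j = b := by
  classical
  obtain ⟨h0, -, hmem, hmono, -, -⟩ := hf
  obtain ⟨haS, hbS, hlt, hgap⟩ := hab
  obtain ⟨x, hx, hfx⟩ := hsurj a haS (by omega)
  obtain ⟨y, hy, hfy⟩ := hsurj b hbS hb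
  have hex : ∃ j, j ∈ S ∧ b ≤ f j := ⟨y, hy, hfy.ge⟩
  obtain ⟨j, ⟨hj, hfj⟩, hjmin⟩ : ∃ j, (j ∈ S ∧ b ≤ f j) ∧ ∀ k, k ∈ S ∧ b ≤ f k → j ≤ k :=
    ⟨Nat.find hex, Nat.find_spec hex, fun k hk => Nat.find_min' hex hk⟩
  have hxj : x < j := by
    by_contra! hjx
    have := hmono j hj x hx hjx
    omega
  set i := Nat.findGreatest (fun k => k ∈ S ∧ k < j) j
  have hi : i ∈ S ∧ i < j :=
    Nat.findGreatest_spec (P := fun k => k ∈ S ∧ k < j) hxj.le ⟨hx, hxj⟩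
  have himax : ∀ k ∈ S, k < j → k ≤ i := fun k hk hkj =>
    Nat.le_findGreatest (P := fun k => k ∈ S ∧ k < j) hkj.le ⟨hk, hkj⟩
  have hfi_lt : f i < b := by
    by_contra! hle
    have := hjmin i ⟨hi.1, hle⟩
    omega
  have hfi_ge : a ≤ f i := hfx ▸ hmono x hx i hi.1 (himax x hx hxj)
  have hfj_le : f j ≤ b := hfy ▸ hmono j hj y hy (hjmin y ⟨hy, hfy.ge⟩)
  refine ⟨i, j, ⟨hi.1, hj, hi.2, fun k hk hkk => ?_⟩, ?_, by omega⟩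
  · have := himax k hk hkk.2
    omega
  · have := hgap (f i) (hmem i hi.1).1
    omega

/-- If `f` is constant or an isometry on every gap longer than `L`, then it is so on every gap of
length `L`. -/
theorem eq_or_eq_add_of_longer_gaps {g : ℕ} {S : Set ℕ} {f : ℕ → ℕ} (hS : StableSet g S)
    (hf : AdaptedTo g S f) (hsurj : ∀ m ∈ S, m ≤ g → ∃ i ∈ S, f i = m) {L : ℕ}
    (hlong : ∀ i j, IsGap S i j → L < j - i → f i = f j ∨ f j = f i + (j - i))
    {i : ℕ} (hi : IsGap S i (i + L)) : f i = f (i + L) ∨ f (i + L) = f i + L := by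
  classical
  have hgS : g ∈ S := by
    have := (hf.2.2.1 _ (hS.2.2 0 hS.1)).1
    rwa [Nat.sub_zero, hf.2.1] at this
  have hL : 0 < L := by have := hi.2.2.1; omega
  have hhalf : ∀ {k}, IsGap S k (k + L) → k + L ≤ g ∨ g ≤ k := fun {k} hk => by
    have := hk.2.2.2 g hgS
    omega
  have hrefl : ∀ {k}, IsGap S k (k + L) → IsGap S (2 * g - (k + L)) (2 * g - (k + L) + L) :=
    fun {k} hk => by
      have h := hk.reflect hS
      have := hS.2.1 _ hk.2.1
      rwa [show 2 * g - k = 2 * g - (k + L) + L by omega] at h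
  have hconst : ∀ {k}, IsGap S k (k + L) → f (k + L) = f k + L →
      f (2 * g - (k + L)) = f (2 * g - (k + L) + L) := fun {k} hk he => by
    have h := hf.2.2.2.2.2 k hk.1 (k + L) hk.2.1 hk.2.2.1 hk.2.2.2 (by omega)
    have := hS.2.1 _ hk.2.1
    rwa [show 2 * g - k = 2 * g - (k + L) + L by omega] at h
  let A : Finset ℕ := (Finset.range (g + 1)).filter fun a => IsGap S a (a + L) ∧ a + L ≤ g
  have hA : ∀ a, a ∈ A ↔ IsGap S a (a + L) ∧ a + L ≤ g := fun a => by
    simp only [A, Finset.mem_filter, Finset.mem_range]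
    exact ⟨fun h => h.2, fun h => ⟨by omega, h⟩⟩
  have hlift : ∀ a ∈ A, ∃ k, IsGap S k (k + L) ∧ f k = a ∧ f (k + L) = a + L := fun a ha => by
    obtain ⟨hgap, hle⟩ := (hA a).1 ha
    obtain ⟨k, l, hkl, hk, hl⟩ := exists_isGap_map_eq hf hsurj hgap hle
    have hcon := hf.2.2.2.2.1 k hkl.1 l hkl.2.1 hkl.2.2.1
    have hlt := hkl.2.2.1
    have hlen : l = k + L := by
      by_contra hne
      have := hlong k l hkl (by omega)
      omega
    subst hlen
    exact ⟨k, hkl, hk, hl⟩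
  choose! J hJgap hJ hJL using hlift
  let fold : ℕ → ℕ := fun k => if k + L ≤ g then k else 2 * g - (k + L)
  have hfoldA : ∀ {k}, IsGap S k (k + L) → fold k ∈ A := fun {k} hk => by
    rw [hA]
    by_cases h : k + L ≤ g
    · simpa only [fold, if_pos h] using ⟨hk, h⟩
    · have := hhalf hk
      have hb := hS.2.1 _ hk.2.1
      simp only [fold, if_neg h]
      exact ⟨hrefl hk, by omega⟩
  have hfold_eq : ∀ {k l}, IsGap S k (k + L) → IsGap S l (l + L) → fold k = fold l →
      k = l ∨ k = 2 * g - (l + L) := fun {k l} hk hl h => by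
    have hbk := hS.2.1 _ hk.2.1
    have hbl := hS.2.1 _ hl.2.1
    simp only [fold] at h
    split_ifs at h <;> omega
  have hinj : Set.InjOn (fun a => fold (J a)) A := fun a ha b hb hab => by
    rcases hfold_eq (hJgap a ha) (hJgap b hb) hab with h | h
    · rw [← hJ a ha, h, hJ b hb]
    · have hc := hconst (hJgap b hb) (by rw [hJL b hb, hJ b hb])
      rw [← h, hJ a ha, hJL a ha] at hc
      omega
  have hmaps : Set.MapsTo (fun a => fold (J a)) A A := fun a ha => hfoldA (hJgap a ha)
  obtain ⟨a, ha, hai⟩ :=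
    Finset.surjOn_of_injOn_of_card_le _ hmaps hinj le_rfl (hfoldA hi)
  have hexact : f (J a + L) = f (J a) + L := by rw [hJL a ha, hJ a ha]
  rcases hfold_eq hi (hJgap a ha) hai.symm with h | h
  · exact Or.inr (h ▸ hexact)
  · exact Or.inl (h ▸ hconst (hJgap a ha) hexact)

/-- if `S` is stable and `f` is adapted to `S` and surjective
onto `S ∩ {0,…,g}`, then for any two consecutive `i < j` in `S` either
`f(i) = f(j)` or `f(j) − f(i) = j − i`. -/
theorem stmt10 (g : ℕ) (hg : 1 ≤ g) (S : Set ℕ) (f : ℕ → ℕ)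
    (hS : StableSet g S) (hf : AdaptedTo g S f)
    (hsurj : ∀ m ∈ S, m ≤ g → ∃ i ∈ S, f i = m) :
    ∀ i ∈ S, ∀ j ∈ S, i < j → (∀ k ∈ S, ¬(i < k ∧ k < j)) →
      f i = f j ∨ f j = f i + (j - i) := by
  have main : ∀ n i j, IsGap S i j → 2 * g - (j - i) = n → f i = f j ∨ f j = f i + (j - i) := by
    intro n
    induction n using Nat.strong_induction_on with
    | _ n ih =>
      intro i j hij hn
      obtain ⟨L, rfl⟩ := Nat.exists_eq_add_of_lt hij.2.2.1
      have hlen : i + L + 1 - i = L + 1 := by omega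
      rw [hlen] at hn ⊢
      refine eq_or_eq_add_of_longer_gaps hS hf hsurj (L := L + 1) (fun k l hkl hlt => ?_) hij
      have := hS.2.1 l hkl.2.1
      exact ih _ (by omega) k l hkl rfl
  intro i hi j hj hij hgap
  exact main _ i j ⟨hi, hj, hij, hgap⟩ rfl
end

section
/- Let g ≥ 1. Call a pair (S,f) minimally stable if S ⊆ {0,1,...,2g} is stable, f is adapted to S, and there is no proper stable subset T ⊊ S with f(T) ⊆ T such that the restriction of f to T is adapted to T. If (S,f) is minimally stable, then the function ν : {0,1,...,2g} → {0,1,...,g} obtained from f by linear interpolation between consecutive elements of S (i.e. ν(t) = f(i) + (t−i)(f(j)−f(i))/(j−i) for consecutive i < j in S and i ≤ t ≤ j; these values are integers since each slope is 0 or 1) is a final type of degree g, S equals the canonical domain C_ν, and ν is the unique final type extending f. Conversely, if ν is a final type of degree g then (C_ν, ν|_{C_ν}) is minimally stable. -/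
/-- `(S,f)` is minimally stable: `S` is stable, `f` is adapted to `S`, and no
proper stable subset `T ⊊ S` with `f(T) ⊆ T` has `f` adapted to it. -/
def MinimallyStable (g : ℕ) (S : Set ℕ) (f : ℕ → ℕ) : Prop :=
  StableSet g S ∧ AdaptedTo g S f ∧
    ¬ ∃ T : Set ℕ, T ⊂ S ∧ StableSet g T ∧ (∀ i ∈ T, f i ∈ T) ∧ AdaptedTo g T f

/-- The canonical domain `C_ν`: the smallest subset of `{0,…,2g}` containing
`0` and `2g` and closed under `j ↦ 2g − j` and `j ↦ ν(j)`. -/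
def canDom (g : ℕ) (ν : ℕ → ℕ) : Set ℕ :=
  ⋂₀ {T : Set ℕ | 0 ∈ T ∧ 2 * g ∈ T ∧ (∀ j ∈ T, 2 * g - j ∈ T) ∧ ∀ j ∈ T, ν j ∈ T}

/-- The function obtained from `f` by linear interpolation between consecutive
elements of `S`: for `i ≤ t ≤ j` with `i,j` consecutive in `S`,
`ν(t) = f(i) + (t − i)·(f(j) − f(i))/(j − i)`. -/
noncomputable def interp (g : ℕ) (S : Set ℕ) (f : ℕ → ℕ) : ℕ → ℕ := fun t =>
  let i := sSup {s : ℕ | s ∈ S ∧ s ≤ t}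
  let j := sInf {s : ℕ | s ∈ S ∧ t ≤ s}
  f i + (t - i) * (f j - f i) / (j - i)

/-- `i < j` are consecutive elements of `S`. -/
def ConsecutiveIn (S : Set ℕ) (i j : ℕ) : Prop :=
  i ∈ S ∧ j ∈ S ∧ i < j ∧ ∀ k ∈ S, ¬(i < k ∧ k < j)

theorem exists_consecutiveIn {S : Set ℕ} {x y t : ℕ} (hx : x ∈ S) (hy : y ∈ S)
    (hxt : x ≤ t) (hty : t < y) :
    ∃ i j, ConsecutiveIn S i j ∧ x ≤ i ∧ i ≤ t ∧ t < j ∧ j ≤ y := by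
  classical
  have hi := Nat.findGreatest_spec (P := (· ∈ S)) hxt hx
  have hj : ∃ j, j ∈ S ∧ t < j := ⟨y, hy, hty⟩
  refine ⟨Nat.findGreatest (· ∈ S) t, Nat.find hj,
    ⟨hi, (Nat.find_spec hj).1, (Nat.findGreatest_le t).trans_lt (Nat.find_spec hj).2, ?_⟩,
    Nat.le_findGreatest hxt hx, Nat.findGreatest_le t, (Nat.find_spec hj).2,
    Nat.find_min' hj ⟨hy, hty⟩⟩
  rintro k hk ⟨hik, hkj⟩
  rcases le_or_gt k t with h | h
  · exact absurd (Nat.le_findGreatest (P := (· ∈ S)) h hk) (by omega)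
  · exact Nat.find_min hj hkj ⟨hk, h⟩

theorem consecutiveIn_induction {S : Set ℕ} {x : ℕ} (hx : x ∈ S) {R : ℕ → Prop} (base : R x)
    (step : ∀ z y, ConsecutiveIn S z y → x ≤ z → R z → R y) :
    ∀ y ∈ S, x ≤ y → R y := by
  intro y
  induction y using Nat.strong_induction_on with
  | _ y ih =>
    intro hy hxy
    rcases hxy.eq_or_lt with rfl | hlt
    · exact base
    obtain ⟨z, w, hc, hxz, hz, hw, hwy⟩ :=
      exists_consecutiveIn (t := y - 1) hx hy (by omega) (by omega)
    obtain rfl : w = y := by omega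
    exact step z w hc hxz (ih z hc.2.2.1 hc.1 hxz)

theorem ConsecutiveIn.dual {g : ℕ} {S : Set ℕ} (hS : StableSet g S) {i j : ℕ}
    (h : ConsecutiveIn S i j) : ConsecutiveIn S (2 * g - j) (2 * g - i) := by
  obtain ⟨hi, hj, hij, hk⟩ := h
  have := hS.2.1 j hj
  refine ⟨hS.2.2 j hj, hS.2.2 i hi, by omega, fun k hkS hlt => ?_⟩
  have := hS.2.1 k hkS
  exact hk _ (hS.2.2 k hkS) (by omega)

/-- A rapidly growing superadditive weight on block lengths. -/
def blockWeight (n : ℕ) : ℤ := 3 ^ n - 1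

theorem blockWeight_add_le (m n : ℕ) :
    blockWeight m + blockWeight n ≤ blockWeight (m + n) := by
  have hm : (1 : ℤ) ≤ 3 ^ m := one_le_pow₀ (by norm_num)
  have hn : (1 : ℤ) ≤ 3 ^ n := one_le_pow₀ (by norm_num)
  simp only [blockWeight, pow_add]
  nlinarith [mul_nonneg (sub_nonneg.2 hm) (sub_nonneg.2 hn)]

theorem blockWeight_add_lt {a b l : ℕ} (ha : a < l) (hb : b < l) :
    blockWeight a + blockWeight b < blockWeight l := by
  obtain ⟨n, rfl⟩ : ∃ n, l = n + 1 := ⟨l - 1, by omega⟩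
  have h1 : (3 : ℤ) ^ a ≤ 3 ^ n := pow_le_pow_right₀ (by norm_num) (by omega)
  have h2 : (3 : ℤ) ^ b ≤ 3 ^ n := pow_le_pow_right₀ (by norm_num) (by omega)
  have h3 : (0 : ℤ) < 3 ^ n := by positivity
  simp only [blockWeight, pow_succ]
  linarith

open Classical in
/-- The total weight of the blocks of `S` that start below `x`. -/
noncomputable def totalWeight (S : Set ℕ) (x : ℕ) : ℤ :=
  ∑ u ∈ Finset.range x, if u ∈ S then blockWeight (sInf {s | s ∈ S ∧ u < s} - u) else 0

theorem totalWeight_of_consecutiveIn {S : Set ℕ} {i j : ℕ} (h : ConsecutiveIn S i j) :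
    totalWeight S j = totalWeight S i + blockWeight (j - i) := by
  classical
  obtain ⟨hi, hj, hij, hk⟩ := h
  have hnext : sInf {s | s ∈ S ∧ i < s} = j := by
    refine le_antisymm (Nat.sInf_le ⟨hj, hij⟩) (le_csInf ⟨j, hj, hij⟩ ?_)
    rintro s ⟨hs, his⟩
    exact not_lt.1 fun hsj => hk s hs ⟨his, hsj⟩
  have key : ∀ y, i + 1 ≤ y → y ≤ j →
      totalWeight S y = totalWeight S i + blockWeight (j - i) := by
    intro y hy
    induction y, hy using Nat.le_induction with
    | base =>
      intro _
      rw [totalWeight, Finset.sum_range_succ, if_pos hi, hnext, totalWeight]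
    | succ y hy ih =>
      intro hyj
      rw [← ih (by omega), totalWeight, Finset.sum_range_succ,
        if_neg fun hyS => hk y hyS ⟨by omega, by omega⟩, add_zero, totalWeight]
  exact key j hij le_rfl

theorem totalWeight_le {S : Set ℕ} {x y : ℕ} (hx : x ∈ S) (hy : y ∈ S) (hxy : x ≤ y) :
    totalWeight S y ≤ totalWeight S x + blockWeight (y - x) := by
  refine consecutiveIn_induction hx
    (R := fun y => totalWeight S y ≤ totalWeight S x + blockWeight (y - x))
    (by simp [blockWeight]) (fun z y hc hxz ih => ?_) y hy hxy
  have h := blockWeight_add_le (z - x) (y - z)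
  rw [show z - x + (y - z) = y - x by have := hc.2.2.1; omega] at h
  rw [totalWeight_of_consecutiveIn hc]
  linarith

/-- `f` has slope `0` or `1` on `[i, j]`, and the other slope on the dual block. -/
def DualSlopes (g : ℕ) (f : ℕ → ℕ) (i j : ℕ) : Prop :=
  (f j = f i + (j - i) ∧ f (2 * g - i) = f (2 * g - j)) ∨
    (f j = f i ∧ f (2 * g - i) = f (2 * g - j) + (j - i))

theorem AdaptedTo.dualSlopes {g : ℕ} {S : Set ℕ} {f : ℕ → ℕ} (hS : StableSet g S)
    (hf : AdaptedTo g S f) {i j : ℕ} (hc : ConsecutiveIn S i j) : DualSlopes g f i j := by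
  obtain ⟨h0, h2g, hmap, hmono, hcontr, hdual⟩ := hf
  have hgS : g ∈ S := h2g ▸ (hmap _ (hS.2.2 0 hS.1)).1
  -- `E` is monotone on `S ∩ [0, g]` and takes the same value at both ends
  let E : ℕ → ℤ := fun x => totalWeight S x - totalWeight S (f x) + totalWeight S (f (2 * g - x))
  have step : ∀ i j, ConsecutiveIn S i j → DualSlopes g f i j ∨ E i < E j := by
    intro i j hc
    have hc' := hc.dual hS
    obtain ⟨hi, hj, hij, hk⟩ := hc
    obtain ⟨hj', hi', hij', hk'⟩ := hc'
    have hj2 := hS.2.1 j hj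
    have e1 := hmono i hi j hj hij.le
    have e2 := hmono _ hj' _ hi' hij'.le
    have e3 := hcontr i hi j hj hij
    have e4 := hcontr _ hj' _ hi' hij'
    have e5 := hdual i hi j hj hij hk
    have e6 := hdual _ hj' _ hi' hij' hk'
    rw [show 2 * g - (2 * g - i) = i by omega, show 2 * g - (2 * g - j) = j by omega] at e6
    by_cases hgood : DualSlopes g f i j
    · exact Or.inl hgood
    right
    have w1 := totalWeight_le (hmap i hi).1 (hmap j hj).1 e1
    have w2 := totalWeight_le (hmap _ hj').1 (hmap _ hi').1 e2
    have w3 := totalWeight_of_consecutiveIn ⟨hi, hj, hij, hk⟩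
    have w4 : blockWeight (f j - f i) + blockWeight (f (2 * g - i) - f (2 * g - j))
        < blockWeight (j - i) := by
      unfold DualSlopes at hgood
      refine blockWeight_add_lt ?_ ?_ <;> by_contra hcon
      · have h1 : f j = f i + (j - i) := by omega
        exact hgood (Or.inl ⟨h1, (e5 h1).symm⟩)
      · have h1 : f (2 * g - i) = f (2 * g - j) + (2 * g - i - (2 * g - j)) := by omega
        exact hgood (Or.inr ⟨(e6 h1).symm, by omega⟩)
    simp only [E]
    linarith
  have hEle : ∀ i j, ConsecutiveIn S i j → E i ≤ E j := by
    intro i j hc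
    rcases step i j hc with h | h
    · have hc' := hc.dual hS
      have hj2 := hS.2.1 j hc.2.1
      have w1 := totalWeight_le (hmap i hc.1).1 (hmap j hc.2.1).1
        (hmono i hc.1 j hc.2.1 hc.2.2.1.le)
      have w2 := totalWeight_le (hmap _ hc'.1).1 (hmap _ hc'.2.1).1
        (hmono _ hc'.1 _ hc'.2.1 hc'.2.2.1.le)
      have w3 := totalWeight_of_consecutiveIn hc
      simp only [E]
      rcases h with ⟨h1, h2⟩ | ⟨h1, h2⟩
      · rw [h1, Nat.add_sub_cancel_left] at w1
        rw [h1, h2]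
        linarith
      · rw [h2, Nat.add_sub_cancel_left] at w2
        rw [h1, h2]
        linarith
    · exact h.le
  have hEmono : ∀ x ∈ S, ∀ y ∈ S, x ≤ y → E x ≤ E y := fun x hx y hy hxy =>
    consecutiveIn_induction hx (R := fun y => E x ≤ E y) le_rfl
      (fun z y hc _ ih => ih.trans (hEle z y hc)) y hy hxy
  have hends : E 0 = E g := by
    simp only [E, h0, Nat.sub_zero, h2g, show 2 * g - g = g by omega]
    ring
  have lower : ∀ i j, ConsecutiveIn S i j → j ≤ g → DualSlopes g f i j := by
    intro i j hc hjg
    refine (step i j hc).resolve_right fun hlt => ?_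
    have := hEmono 0 hS.1 i hc.1 (Nat.zero_le _)
    have := hEmono j hc.2.1 g hgS hjg
    linarith
  rcases le_or_gt j g with hjg | hjg
  · exact lower i j hc hjg
  have hig : g ≤ i := not_lt.1 fun h => hc.2.2.2 g hgS ⟨h, hjg⟩
  have hj2 := hS.2.1 j hc.2.1
  have hij := hc.2.2.1
  have h := lower _ _ (hc.dual hS) (by omega)
  unfold DualSlopes at h ⊢
  rw [show 2 * g - (2 * g - i) = i by omega, show 2 * g - (2 * g - j) = j by omega,
    show 2 * g - i - (2 * g - j) = j - i by omega] at h
  tauto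

theorem interp_of_mem {g : ℕ} {S : Set ℕ} {f : ℕ → ℕ} {t : ℕ} (ht : t ∈ S) :
    interp g S f t = f t := by
  have h1 : sSup {s | s ∈ S ∧ s ≤ t} = t :=
    (show IsGreatest {s | s ∈ S ∧ s ≤ t} t from ⟨⟨ht, le_rfl⟩, fun _ h => h.2⟩).csSup_eq
  simp [interp, h1]

theorem interp_of_consecutiveIn {g : ℕ} {S : Set ℕ} {f : ℕ → ℕ} {i j t : ℕ}
    (hc : ConsecutiveIn S i j) (hit : i ≤ t) (htj : t ≤ j) :
    interp g S f t = f i + (t - i) * (f j - f i) / (j - i) ∨ t = j := by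
  rcases htj.eq_or_lt with h | htj
  · exact Or.inr h
  left
  obtain ⟨hi, hj, hij, hk⟩ := hc
  rcases hit.eq_or_lt with rfl | hit
  · simp [interp_of_mem hi]
  have h1 : sSup {s | s ∈ S ∧ s ≤ t} = i :=
    (show IsGreatest {s | s ∈ S ∧ s ≤ t} i from ⟨⟨hi, hit.le⟩, fun s h =>
      not_lt.1 fun his => hk s h.1 ⟨his, h.2.trans_lt htj⟩⟩).csSup_eq
  have h2 : sInf {s | s ∈ S ∧ t ≤ s} = j :=
    (show IsLeast {s | s ∈ S ∧ t ≤ s} j from ⟨⟨hj, htj.le⟩, fun s h =>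
      not_lt.1 fun hsj => hk s h.1 ⟨hit.trans_le h.2, hsj⟩⟩).csInf_eq
  simp [interp, h1, h2]

theorem interp_of_slope_one {g : ℕ} {S : Set ℕ} {f : ℕ → ℕ} {i j t : ℕ}
    (hc : ConsecutiveIn S i j) (hit : i ≤ t) (htj : t ≤ j) (h : f j = f i + (j - i)) :
    interp g S f t = f i + (t - i) := by
  rcases interp_of_consecutiveIn (g := g) (f := f) hc hit htj with e | rfl
  · have := hc.2.2.1
    rw [e, h, Nat.add_sub_cancel_left, Nat.mul_div_cancel _ (by omega)]
  · rw [interp_of_mem hc.2.1, h]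

theorem interp_of_slope_zero {g : ℕ} {S : Set ℕ} {f : ℕ → ℕ} {i j t : ℕ}
    (hc : ConsecutiveIn S i j) (hit : i ≤ t) (htj : t ≤ j) (h : f j = f i) :
    interp g S f t = f i := by
  rcases interp_of_consecutiveIn (g := g) (f := f) hc hit htj with e | rfl
  · simp [e, h]
  · rw [interp_of_mem hc.2.1, h]

theorem interp_of_gt {g : ℕ} {S : Set ℕ} {f : ℕ → ℕ} (hS : StableSet g S) {t : ℕ}
    (ht : 2 * g < t) : interp g S f t = f (2 * g) := by
  have h1 : sSup {s | s ∈ S ∧ s ≤ t} = 2 * g :=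
    (show IsGreatest {s | s ∈ S ∧ s ≤ t} (2 * g) from
      ⟨⟨hS.2.2 0 hS.1, ht.le⟩, fun s h => hS.2.1 s h.1⟩).csSup_eq
  have h2 : {s | s ∈ S ∧ t ≤ s} = ∅ :=
    Set.eq_empty_of_forall_notMem fun s h => absurd (hS.2.1 s h.1) (by have := h.2; omega)
  simp [interp, h1, h2]

theorem interp_succ {g : ℕ} {S : Set ℕ} {f : ℕ → ℕ} (hS : StableSet g S)
    (hf : AdaptedTo g S f) {t : ℕ} (ht : t < 2 * g) :
    DualSlopes g (interp g S f) t (t + 1) := by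
  obtain ⟨i, j, hc, -, hit, htj, hj⟩ :=
    exists_consecutiveIn hS.1 (hS.2.2 0 hS.1) (Nat.zero_le t) ht
  have hc' := hc.dual hS
  have hlen : 2 * g - i - (2 * g - j) = j - i := by omega
  rcases hf.dualSlopes hS hc with ⟨h1, h2⟩ | ⟨h1, h2⟩
  · left
    rw [interp_of_slope_one hc hit htj.le h1, interp_of_slope_one hc (by omega) htj h1,
      interp_of_slope_zero hc' (by omega) (by omega) h2,
      interp_of_slope_zero hc' (by omega) (by omega) h2]
    omega
  · right
    rw [← hlen] at h2
    rw [interp_of_slope_zero hc hit htj.le h1, interp_of_slope_zero hc (by omega) htj h1,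
      interp_of_slope_one hc' (by omega) (by omega) h2,
      interp_of_slope_one hc' (by omega) (by omega) h2]
    omega

theorem isFinalType_interp {g : ℕ} {S : Set ℕ} {f : ℕ → ℕ} (hS : StableSet g S)
    (hf : AdaptedTo g S f) : IsFinalType g (interp g S f) := by
  have h0 : interp g S f 0 = 0 := (interp_of_mem hS.1).trans hf.1
  have h2g : interp g S f (2 * g) = g := (interp_of_mem (hS.2.2 0 hS.1)).trans hf.2.1
  have hmono : ∀ i j, i ≤ j → j ≤ 2 * g → interp g S f i ≤ interp g S f j := by
    intro i j hij
    induction j, hij using Nat.le_induction with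
    | base => exact fun _ => le_rfl
    | succ j _ ih =>
      intro hj
      have := ih (by omega)
      rcases interp_succ hS hf (t := j) (by omega) with h | h <;> omega
  have hdual : ∀ i, i ≤ 2 * g → interp g S f (2 * g - i) + i = interp g S f i + g := by
    intro i
    induction i with
    | zero => intro _; simp [h0, h2g]
    | succ i ih =>
      intro hi
      have := ih (by omega)
      rcases interp_succ hS hf (t := i) (by omega) with h | h <;> omega
  have hsurj : ∀ n, n ≤ 2 * g → ∀ m, m ≤ interp g S f n → ∃ i, i ≤ n ∧ interp g S f i = m := by
    intro n
    induction n with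
    | zero => exact fun _ m hm => ⟨0, le_rfl, by omega⟩
    | succ n ih =>
      intro hn m hm
      by_cases hmn : m ≤ interp g S f n
      · obtain ⟨i, hi, e⟩ := ih (by omega) m hmn
        exact ⟨i, by omega, e⟩
      · refine ⟨n + 1, le_rfl, ?_⟩
        rcases interp_succ hS hf (t := n) (by omega) with h | h <;> omega
  refine ⟨fun i hi => ?_, hmono, fun m hm => hsurj (2 * g) le_rfl m (by omega),
    fun i hi => hdual i (by omega), fun i hi => (interp_of_gt hS hi).trans hf.2.1⟩
  simpa [h2g] using hmono i (2 * g) hi le_rfl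

theorem IsFinalType.dual {g : ℕ} {ν : ℕ → ℕ} (hν : IsFinalType g ν) {i : ℕ} (hi : i ≤ 2 * g) :
    ν (2 * g - i) + i = ν i + g := by
  rcases le_or_gt i g with h | h
  · exact hν.2.2.2.1 i h
  · have := hν.2.2.2.1 (2 * g - i) (by omega)
    rw [show 2 * g - (2 * g - i) = i by omega] at this
    omega

theorem IsFinalType.map_zero_s11 {g : ℕ} {ν : ℕ → ℕ} (hν : IsFinalType g ν) : ν 0 = 0 := by
  obtain ⟨i, hi, e⟩ := hν.2.2.1 0 (Nat.zero_le g)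
  have := hν.2.1 0 i (Nat.zero_le i) hi
  omega

theorem IsFinalType.map_two_mul {g : ℕ} {ν : ℕ → ℕ} (hν : IsFinalType g ν) : ν (2 * g) = g := by
  simpa [hν.map_zero_s11] using hν.dual (Nat.zero_le (2 * g))

theorem IsFinalType.map_le_add {g : ℕ} {ν : ℕ → ℕ} (hν : IsFinalType g ν) {i j : ℕ}
    (hij : i ≤ j) (hj : j ≤ 2 * g) : ν j ≤ ν i + (j - i) := by
  have := hν.dual hj
  have := hν.dual (hij.trans hj)
  have := hν.2.1 (2 * g - j) (2 * g - i) (by omega) (by omega)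
  omega

theorem IsFinalType.adaptedTo {g : ℕ} {ν f : ℕ → ℕ} {T : Set ℕ} (hν : IsFinalType g ν)
    (hT : StableSet g T) (hfν : ∀ i ∈ T, ν i = f i) (hmap : ∀ i ∈ T, f i ∈ T) :
    AdaptedTo g T f := by
  refine ⟨?_, ?_, ?_, ?_, ?_, ?_⟩
  · rw [← hfν 0 hT.1, hν.map_zero_s11]
  · rw [← hfν (2 * g) (hT.2.2 0 hT.1), hν.map_two_mul]
  · exact fun i hi => ⟨hmap i hi, hfν i hi ▸ hν.1 i (hT.2.1 i hi)⟩
  · intro i hi j hj hij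
    rw [← hfν i hi, ← hfν j hj]
    exact hν.2.1 i j hij (hT.2.1 j hj)
  · intro i hi j hj hij
    rw [← hfν i hi, ← hfν j hj]
    exact hν.map_le_add hij.le (hT.2.1 j hj)
  · intro i hi j hj hij _ e
    rw [← hfν i hi, ← hfν j hj] at e
    rw [← hfν _ (hT.2.2 i hi), ← hfν _ (hT.2.2 j hj)]
    have := hν.dual (hT.2.1 i hi)
    have := hν.dual (hT.2.1 j hj)
    omega

theorem canDom_subset {g : ℕ} {ν : ℕ → ℕ} {T : Set ℕ} (hT : StableSet g T)
    (hmap : ∀ i ∈ T, ν i ∈ T) : canDom g ν ⊆ T :=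
  Set.sInter_subset_of_mem ⟨hT.1, hT.2.2 0 hT.1, hT.2.2, hmap⟩

theorem map_mem_canDom {g : ℕ} {ν : ℕ → ℕ} {i : ℕ} (hi : i ∈ canDom g ν) : ν i ∈ canDom g ν :=
  fun T hT => hT.2.2.2 i (hi T hT)

theorem IsFinalType.stableSet_canDom {g : ℕ} {ν : ℕ → ℕ} (hν : IsFinalType g ν) :
    StableSet g (canDom g ν) := by
  refine ⟨fun T hT => hT.1, fun i hi => ?_, fun i hi T hT => hT.2.2.1 i (hi T hT)⟩
  refine hi {k | k ≤ 2 * g} ⟨Nat.zero_le _, le_refl (2 * g), fun k _ => Nat.sub_le _ _,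
    fun k hk => ?_⟩
  have := hν.1 k hk
  show ν k ≤ 2 * g
  omega

theorem eq_interp_of_isFinalType {g : ℕ} {S : Set ℕ} {f ν : ℕ → ℕ} (hS : StableSet g S)
    (hf : AdaptedTo g S f) (hν : IsFinalType g ν) (hext : ∀ i ∈ S, ν i = f i) :
    ν = interp g S f := by
  funext t
  rcases lt_trichotomy t (2 * g) with ht | rfl | ht
  · obtain ⟨i, j, hc, -, hit, htj, hj⟩ :=
      exists_consecutiveIn hS.1 (hS.2.2 0 hS.1) (Nat.zero_le t) ht
    have ei := hext i hc.1
    have ej := hext j hc.2.1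
    rcases hf.dualSlopes hS hc with ⟨h, -⟩ | ⟨h, -⟩
    · rw [interp_of_slope_one hc hit htj.le h]
      have := hν.map_le_add hit ht.le
      have := hν.map_le_add htj.le hj
      omega
    · rw [interp_of_slope_zero hc hit htj.le h]
      have := hν.2.1 i t hit ht.le
      have := hν.2.1 t j htj.le hj
      omega
  · have h := hS.2.2 0 hS.1
    exact (hext _ h).trans (interp_of_mem h).symm
  · rw [interp_of_gt hS ht, hν.2.2.2.2 t ht, hf.2.1]

/-- if `(S,f)` is minimally stable then the linear interpolation
`ν` of `f` is a final type of degree `g` extending `f`, `C_ν = S`, and `ν` is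
the unique final type extending `f`; conversely if `ν` is a final type then
`(C_ν, ν|_{C_ν})` is minimally stable. -/
theorem stmt11 (g : ℕ) (hg : 1 ≤ g) :
    (∀ (S : Set ℕ) (f : ℕ → ℕ), MinimallyStable g S f →
      IsFinalType g (interp g S f) ∧
      (∀ i ∈ S, interp g S f i = f i) ∧
      canDom g (interp g S f) = S ∧
      (∀ ν : ℕ → ℕ, IsFinalType g ν → (∀ i ∈ S, ν i = f i) → ν = interp g S f)) ∧
    (∀ ν : ℕ → ℕ, IsFinalType g ν → MinimallyStable g (canDom g ν) ν) := by

  refine ⟨fun S f ⟨hS, hf, hmin⟩ => ?_, fun ν hν => ⟨hν.stableSet_canDom, ?_, ?_⟩⟩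
  · have hν := isFinalType_interp hS hf
    have hext : ∀ i ∈ S, interp g S f i = f i := fun i hi => interp_of_mem hi
    refine ⟨hν, hext, ?_, fun ν hν' h => eq_interp_of_isFinalType hS hf hν' h⟩
    have hsub : canDom g (interp g S f) ⊆ S :=
      canDom_subset hS fun i hi => (hext i hi).symm ▸ (hf.2.2.1 i hi).1
    have hext' : ∀ i ∈ canDom g (interp g S f), interp g S f i = f i :=
      fun i hi => hext i (hsub hi)
    have hmap : ∀ i ∈ canDom g (interp g S f), f i ∈ canDom g (interp g S f) :=
      fun i hi => hext' i hi ▸ map_mem_canDom hi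
    by_contra hne
    exact hmin ⟨_, hsub.ssubset_of_ne hne, hν.stableSet_canDom, hmap,
      hν.adaptedTo hν.stableSet_canDom hext' hmap⟩
  · exact hν.adaptedTo hν.stableSet_canDom (fun _ _ => rfl) fun _ => map_mem_canDom
  · rintro ⟨T, hT, hstable, hmap, -⟩
    exact hT.2 (canDom_subset hstable hmap)
end

section
/- Let k be a field and V a k-vector space of finite dimension n. Consider the equivalence relation on complete flags 0 = E_0 ⊂ E_1 ⊂ ... ⊂ E_n = V (with dim E_i = i) generated by the operations that, for some 1 ≤ i ≤ n−1, replace E_i by an arbitrary i-dimensional subspace E with E_{i−1} ⊆ E ⊆ E_{i+1}, leaving all other members of the flag unchanged. Then any two complete flags of V are equivalent, i.e. this equivalence relation has exactly one equivalence class. -/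
/-- A complete flag `0 = E₀ ⊂ E₁ ⊂ … ⊂ E_n = V` with `dim E_i = i`. -/
def IsCompleteFlag (k V : Type*) [Field k] [AddCommGroup V] [Module k V] (n : ℕ)
    (E : Fin (n + 1) → Submodule k V) : Prop :=
  E 0 = ⊥ ∧ E (Fin.last n) = ⊤ ∧ (∀ i j : Fin (n + 1), i ≤ j → E i ≤ E j) ∧
    ∀ i : Fin (n + 1), Module.finrank k (E i) = (i : ℕ)

/-- An elementary move between complete flags: for some `1 ≤ i ≤ n−1`, replace
`E_i` by an arbitrary `i`-dimensional subspace of `E_{i+1}` containing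
`E_{i−1}`, leaving all other members unchanged.  (Since both sides are
required to be complete flags and agree outside position `i`, the replacement
automatically satisfies `E_{i−1} ⊆ F_i ⊆ E_{i+1}` and `dim F_i = i`.) -/
def ElemMove (k V : Type*) [Field k] [AddCommGroup V] [Module k V] (n : ℕ)
    (E F : Fin (n + 1) → Submodule k V) : Prop :=
  IsCompleteFlag k V n E ∧ IsCompleteFlag k V n F ∧
    ∃ i : Fin (n + 1), 0 < (i : ℕ) ∧ (i : ℕ) < n ∧
      ∀ j : Fin (n + 1), j ≠ i → E j = F j

open Module

section Flags

variable {k V : Type*} [Field k] [AddCommGroup V] [Module k V]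

theorem Submodule.exists_le_finrank_eq_of_finrank_eq_succ [FiniteDimensional k V] {d : ℕ}
    (W : Submodule k V) (hW : finrank k W = d + 1) :
    ∃ U : Submodule k V, U ≤ W ∧ finrank k U = d := by
  obtain ⟨s, hs, hli⟩ :=
    exists_finset_linearIndependent_of_le_finrank (R := k) (M := W) (n := d) (by omega)
  refine ⟨(Submodule.span k (s : Set W)).map W.subtype, Submodule.map_subtype_le _ _, ?_⟩
  rw [Submodule.finrank_map_subtype_eq, finrank_span_finset_eq_card hli,
    hs]

theorem Submodule.exists_chain_finrank_eq [FiniteDimensional k V] (d : ℕ) (W : Submodule k V)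
    (hW : finrank k W = d) :
    ∃ f : ℕ → Submodule k V, Monotone f ∧ (∀ i, f i ≤ W) ∧ ∀ i ≤ d, finrank k (f i) = i := by
  induction d generalizing W with
  | zero =>
    refine ⟨fun _ => W, monotone_const, fun _ => le_rfl, fun i hi => ?_⟩
    rw [hW]
    omega
  | succ d ih =>
    obtain ⟨U, hUW, hU⟩ := W.exists_le_finrank_eq_of_finrank_eq_succ hW
    obtain ⟨f, hf, hfU, hfd⟩ := ih U hU
    refine ⟨fun i => if i ≤ d then f i else W, fun i j hij => ?_, fun i => ?_, fun i hi => ?_⟩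
    · dsimp only
      split_ifs
      · exact hf hij
      · exact (hfU i).trans hUW
      · omega
      · exact le_rfl
    · dsimp only
      split_ifs
      · exact (hfU i).trans hUW
      · exact le_rfl
    · beta_reduce
      by_cases h : i ≤ d
      · rw [if_pos h, hfd i h]
      · rw [if_neg h, hW]
        omega

/-- Two distinct hyperplanes of a common space meet in codimension one. -/
theorem Submodule.finrank_inf_of_ne [FiniteDimensional k V] {e : ℕ} {L M N : Submodule k V}
    (hL : finrank k L = e + 1) (hM : finrank k M = e + 1) (hN : finrank k N = e + 2)
    (hLN : L ≤ N) (hMN : M ≤ N) (hne : L ≠ M) :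
    finrank k (L ⊓ M : Submodule k V) = e := by
  have hsum := Submodule.finrank_sup_add_finrank_inf_eq L M
  have hle := Submodule.finrank_mono (sup_le hLN hMN)
  have hlt : L < L ⊔ M := left_lt_sup.2 fun h =>
    hne (Submodule.eq_of_le_of_finrank_eq h (hM.trans hL.symm)).symm
  have := Submodule.finrank_lt_finrank_of_lt hlt
  omega

/-- The lower part of a complete flag may be replaced by any chain contained in the first
remaining member. -/
theorem IsCompleteFlag.splice [FiniteDimensional k V] {n : ℕ} {E : Fin (n + 1) → Submodule k V}
    (hE : IsCompleteFlag k V n E) {f : ℕ → Submodule k V} (hf : Monotone f) (d : Fin (n + 1))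
    (hfE : ∀ i, f i ≤ E d) (hfd : ∀ i < (d : ℕ), finrank k (f i) = i) :
    IsCompleteFlag k V n fun i => if i < d then f i else E i := by
  obtain ⟨h0, hlast, hmono, hrank⟩ := hE
  refine ⟨?_, ?_, fun i j hij => ?_, fun i => ?_⟩
  · dsimp only
    split_ifs with h
    · exact Submodule.finrank_eq_zero.1 (hfd _ h)
    · exact h0
  · dsimp only
    rw [if_neg (Fin.le_last d).not_gt, hlast]
  · dsimp only
    split_ifs with hi hj hj
    · exact hf hij
    · exact (hfE i).trans (hmono _ _ (not_lt.1 hj))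
    · exact absurd (hij.trans_lt hj) hi
    · exact hmono _ _ hij
  · beta_reduce
    by_cases h : i < d
    · rw [if_pos h, hfd _ h]
    · rw [if_neg h, hrank i]

theorem IsCompleteFlag.eqvGen_of_eq_above [FiniteDimensional k V] {n : ℕ} (m : ℕ)
    {E F : Fin (n + 1) → Submodule k V} (hE : IsCompleteFlag k V n E)
    (hF : IsCompleteFlag k V n F) (hEF : ∀ i : Fin (n + 1), m ≤ (i : ℕ) → E i = F i) :
    Relation.EqvGen (ElemMove k V n) E F := by
  induction m generalizing E F with
  | zero =>
    obtain rfl : E = F := funext fun i => hEF i (Nat.zero_le _)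
    exact .refl _
  | succ m ih =>
    by_cases h : ∀ i : Fin (n + 1), m ≤ (i : ℕ) → E i = F i
    · exact ih hE hF h
    push Not at h
    obtain ⟨d, hmd, hne⟩ := h
    obtain rfl : m = d := by
      by_contra hd
      exact hne (hEF d (by omega))
    have hd0 : 0 < (d : ℕ) := by
      by_contra hd
      obtain rfl : d = 0 := Fin.ext (by simpa using hd)
      exact hne (hE.1.trans hF.1.symm)
    have hdn : (d : ℕ) < n := by
      by_contra hd
      obtain rfl : d = Fin.last n := Fin.ext (by simp; omega)
      exact hne (hE.2.1.trans hF.2.1.symm)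
    obtain ⟨e, he⟩ : ∃ e, (d : ℕ) = e + 1 := ⟨d - 1, by omega⟩
    let s : Fin (n + 1) := ⟨e + 2, by omega⟩
    have hds : d ≤ s := Fin.le_def.2 (by simp only [s]; omega)
    have hs : E s = F s := hEF s (by simp only [s]; omega)
    have hinf : finrank k (E d ⊓ F d : Submodule k V) = e :=
      Submodule.finrank_inf_of_ne ((hE.2.2.2 d).trans he) ((hF.2.2.2 d).trans he)
        (hE.2.2.2 s) (hE.2.2.1 d s hds) (hs ▸ hF.2.2.1 d s hds) hne
    obtain ⟨f, hf, hfle, hfe⟩ := Submodule.exists_chain_finrank_eq e _ hinf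
    have hfd : ∀ i < (d : ℕ), finrank k (f i) = i := fun i hi => hfe i (by omega)
    have hG := hE.splice hf d (fun i => (hfle i).trans inf_le_left) hfd
    have hH := hF.splice hf d (fun i => (hfle i).trans inf_le_right) hfd
    refine .trans _ _ _ (ih hE hG fun i hi => ?_) (.trans _ _ _ (.rel _ _
      ⟨hG, hH, d, hd0, hdn, fun j hj => ?_⟩) (ih hH hF fun i hi => ?_))
    · exact (if_neg (Fin.le_def.2 hi).not_gt).symm
    · dsimp only
      split_ifs with h
      · rfl
      · exact hEF j (lt_of_le_of_ne (not_lt.1 h) hj.symm)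
    · exact if_neg (Fin.le_def.2 hi).not_gt

end Flags

/-- the equivalence relation generated by elementary moves on
complete flags of an `n`-dimensional vector space has exactly one equivalence
class: any two complete flags are equivalent. -/
theorem stmt16 (k V : Type*) [Field k] [AddCommGroup V] [Module k V]
    [FiniteDimensional k V] (n : ℕ) (hn : Module.finrank k V = n)
    (E F : Fin (n + 1) → Submodule k V)
    (hE : IsCompleteFlag k V n E) (hF : IsCompleteFlag k V n F) :
    Relation.EqvGen (ElemMove k V n) E F := by
  exact hE.eqvGen_of_eq_above (n + 1) hF fun i hi => absurd i.isLt (by omega)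
end

section
/- Let f, g ∈ ℤ[X] with f ≠ 0, and assume f and g have no common non-constant factor (equivalently, f and g are coprime in ℚ[X]). Let n be a nonzero integer. Suppose there exists N such that for every prime p > N one has f(p) ≠ 0 and the rational number g(p)/f(p) lies in ℤ[1/n], i.e. there exist a ∈ ℤ and k ≥ 0 with n^k · g(p) = a · f(p). Then f is constant, i.e. deg f = 0. -/
open Polynomial in
/-- Integer polynomials without a common non-constant factor are coprime over `ℚ`. -/
theorem isCoprime_map_of_common_dvd_natDegree_eq_zero {f g : ℤ[X]} (hf : f ≠ 0)
    (hcop : ∀ d : ℤ[X], d ∣ f → d ∣ g → d.natDegree = 0) :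
    IsCoprime (f.map (algebraMap ℤ ℚ)) (g.map (algebraMap ℤ ℚ)) := by
  rw [← EuclideanDomain.gcd_isUnit_iff]
  set D := EuclideanDomain.gcd (f.map (algebraMap ℤ ℚ)) (g.map (algebraMap ℤ ℚ)) with hD
  have hD0 : D ≠ 0 := fun h0 => by
    rw [hD, EuclideanDomain.gcd_eq_zero_iff] at h0
    exact hf ((Polynomial.map_eq_zero_iff (algebraMap ℤ ℚ).injective_int).1 h0.1)
  apply isUnit_or_eq_zero_of_isUnit_integerNormalization_primPart (R := ℤ) hD0
  set E := (IsLocalization.integerNormalization (nonZeroDivisors ℤ) D).primPart with hE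
  have hprim : E.IsPrimitive := isPrimitive_primPart _
  have hED : E.map (algebraMap ℤ ℚ) ∣ D := by
    obtain ⟨b, hb, hbD⟩ := IsLocalization.integerNormalization_spec (nonZeroDivisors ℤ) D
    have h1 := Polynomial.map_dvd (algebraMap ℤ ℚ)
      (IsLocalization.integerNormalization (nonZeroDivisors ℤ) D).primPart_dvd
    have hb0 : (b : ℚ) ≠ 0 := by exact_mod_cast nonZeroDivisors.ne_zero hb
    have hbC : b • D = C (b : ℚ) * D := by simp [zsmul_eq_mul]
    rw [hbD, hbC] at h1
    exact (isUnit_C.2 hb0.isUnit).dvd_mul_left.1 h1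
  have hdeg : E.natDegree = 0 := hcop E
    (hprim.dvd_of_fraction_map_dvd_fraction_map (hED.trans (EuclideanDomain.gcd_dvd_left _ _)))
    (hprim.dvd_of_fraction_map_dvd_fraction_map (hED.trans (EuclideanDomain.gcd_dvd_right _ _)))
  rw [eq_C_of_natDegree_eq_zero hdeg]
  exact isUnit_C.2 (hprim _ (by rw [← eq_C_of_natDegree_eq_zero hdeg]))

open Polynomial in
/-- A non-constant integer polynomial and one sharing no non-constant factor with it
generate an ideal that contains a nonzero constant. -/
theorem exists_mul_add_mul_eq_C_of_common_dvd_natDegree_eq_zero {f g : ℤ[X]}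
    (hf : f.natDegree ≠ 0) (hcop : ∀ d : ℤ[X], d ∣ f → d ∣ g → d.natDegree = 0) :
    ∃ (u v : ℤ[X]) (r : ℤ), r ≠ 0 ∧ f * u + g * v = C r := by
  obtain ⟨u, v, -, -, huv⟩ := exists_mul_add_mul_eq_C_resultant f g le_rfl le_rfl (Or.inl hf)
  refine ⟨u, v, _, fun h0 => ?_, huv⟩
  have hf0 : f ≠ 0 := fun h => hf (by simp [h])
  have h1 := resultant_map_map f g f.natDegree g.natDegree (algebraMap ℤ ℚ)
  rw [h0, map_zero] at h1
  have hinj := (algebraMap ℤ ℚ).injective_int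
  refine resultant_ne_zero _ _ (isCoprime_map_of_common_dvd_natDegree_eq_zero hf0 hcop) ?_
  rwa [natDegree_map_eq_of_injective hinj, natDegree_map_eq_of_injective hinj]

open Polynomial in
/-- If the values of `f` at all large primes are nonzero and only have prime factors
dividing `m`, then `f` is constant. -/
theorem natDegree_eq_zero_of_eval_prime_dvd_pow {f : ℤ[X]} {m : ℤ} (hm : m ≠ 0) {N : ℕ}
    (h : ∀ p : ℕ, p.Prime → N < p → f.eval (p : ℤ) ≠ 0 ∧ ∃ k : ℕ, f.eval (p : ℤ) ∣ m ^ k) :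
    f.natDegree = 0 := by
  obtain ⟨p₀, hle, hp₀⟩ := Nat.exists_infinite_primes (N + m.natAbs + 1)
  obtain ⟨hc0, k₀, hk₀⟩ := h p₀ hp₀ (by lia)
  set c := f.eval (p₀ : ℤ) with hc
  have hpi : Prime (p₀ : ℤ) := Nat.prime_iff_prime_int.1 hp₀
  have hpm : ¬ (p₀ : ℤ) ∣ m := fun hd => by
    have := Nat.le_of_dvd (Int.natAbs_pos.2 hm) (Int.natCast_dvd.1 hd)
    lia
  have hcop : IsCoprime (p₀ : ℤ) ((m * c).natAbs : ℤ) := by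
    rw [Int.natCast_natAbs, IsCoprime.abs_right_iff, hpi.irreducible.coprime_iff_not_dvd]
    intro hd
    rcases hpi.dvd_or_dvd hd with hd | hd
    · exact hpm hd
    · exact hpm (hpi.dvd_of_dvd_pow (hd.trans hk₀))
  have key : f ^ 2 - C (c ^ 2) = 0 := by
    refine eq_zero_of_infinite_isRoot _ ?_
    have hinf : {p : ℕ | (f ^ 2 - C (c ^ 2)).IsRoot (p : ℤ)}.Infinite := by
      rw [Set.infinite_iff_exists_gt]
      intro M
      obtain ⟨p, hgt, hp, hmod⟩ := Nat.forall_exists_prime_gt_and_zmodEq (N + M)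
        (Int.natAbs_ne_zero.2 (mul_ne_zero hm hc0)) hcop
      refine ⟨p, ?_, by lia⟩
      obtain ⟨-, k, hk⟩ := h p hp (by lia)
      have hd : m * c ∣ f.eval (p : ℤ) - c :=
        (Int.natAbs_dvd.1 hmod.symm.dvd).trans (sub_dvd_eval_sub _ _ f)
      obtain ⟨t, ht⟩ := hd
      have hfp : f.eval (p : ℤ) = c * (1 + m * t) := by linear_combination ht
      have hu : IsUnit (1 + m * t) := by
        refine IsCoprime.isUnit_of_dvd' (IsCoprime.pow_right (n := k) ?_) dvd_rfl
          ((Dvd.intro_left c hfp.symm).trans hk)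
        exact ⟨1, -t, by ring⟩
      have hsq : (1 + m * t) ^ 2 = 1 := by
        rcases Int.isUnit_iff.1 hu with h1 | h1 <;> simp [h1]
      simp [hfp, mul_pow, hsq]
    refine (hinf.image (f := fun p : ℕ => (p : ℤ)) Nat.cast_injective.injOn).mono ?_
    rintro _ ⟨p, hp, rfl⟩
    exact hp
  have hdeg := congrArg natDegree (sub_eq_zero.1 key)
  rw [natDegree_pow, natDegree_C] at hdeg
  lia

/-- let `f, g ∈ ℤ[X]` with `f ≠ 0` and with no common
non-constant factor, and let `n` be a nonzero integer.  If there is an `N`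
such that for every prime `p > N` one has `f(p) ≠ 0` and `g(p)/f(p) ∈ ℤ[1/n]`
(i.e. `n^k·g(p) = a·f(p)` for some `a ∈ ℤ`, `k ≥ 0`), then `f` is constant. -/
theorem stmt19 (f g : Polynomial ℤ) (hf : f ≠ 0)
    (hcop : ∀ d : Polynomial ℤ, d ∣ f → d ∣ g → d.natDegree = 0)
    (n : ℤ) (hn : n ≠ 0)
    (h : ∃ N : ℕ, ∀ p : ℕ, p.Prime → N < p →
      f.eval (p : ℤ) ≠ 0 ∧
      ∃ (a : ℤ) (k : ℕ), n ^ k * g.eval (p : ℤ) = a * f.eval (p : ℤ)) :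
    f.natDegree = 0 := by
  by_contra hdeg
  obtain ⟨N, h⟩ := h
  obtain ⟨u, v, r, hr, huv⟩ := exists_mul_add_mul_eq_C_of_common_dvd_natDegree_eq_zero hdeg hcop
  refine hdeg (natDegree_eq_zero_of_eval_prime_dvd_pow (mul_ne_zero hn hr) (N := N)
    fun p hp hNp => ?_)
  obtain ⟨hfp, a, k, hak⟩ := h p hp hNp
  refine ⟨hfp, k + 1, ?_⟩
  have he := congrArg (Polynomial.eval (p : ℤ)) huv
  simp only [Polynomial.eval_add, Polynomial.eval_mul, Polynomial.eval_C] at he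
  have hd : f.eval (p : ℤ) ∣ n ^ k * r :=
    ⟨n ^ k * u.eval (p : ℤ) + a * v.eval (p : ℤ), by
      linear_combination (-n ^ k) * he + v.eval (p : ℤ) * hak⟩
  refine hd.trans ?_
  rw [mul_pow]
  exact mul_dvd_mul (pow_dvd_pow n (Nat.le_succ k)) (dvd_pow_self r (Nat.succ_ne_zero k))
end
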